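/- Let 0 ≤ β ≤ α < 1/q and 0 < q < ∞. (i) If 1 ≤ r < ∞, α + β > 2/q − 1/2 and α + 2β ≥ 3/q − 1/r′, then there is C > 0 such that for every measurable F : ℝ → ℂ one has sup_{t>0} t·|{(x,y) ∈ ℝ² : |R*_{α,β}F(x,y)| > t}|^{1/q} ≤ C · ‖F‖_{L^{r,1}(S¹)}. (ii) If r = ∞, α + β > 2/q − 1/2 and α + 2β > 3/q − 1, then the same weak L^q(ℝ²) bound holds with C · ess sup_{[0,2π]} |F| on the right-hand side. -/

import Mathlib

open MeasureTheory Real Set Filter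
open scoped ENNReal

noncomputable section

/-- Fourier extension operator of the unit circle,
`(R*F)(x,y) = (1/(2π)) ∫_0^{2π} F(φ) exp(i(x cos φ + y sin φ)) dφ`. -/
def Rext (F : ℝ → ℂ) (x y : ℝ) : ℂ :=
  Complex.ofReal (1 / (2 * π)) *
    ∫ φ in (0:ℝ)..(2 * π),
      F φ * Complex.exp (Complex.I * Complex.ofReal (x * Real.cos φ + y * Real.sin φ))

/-- Weighted extension operator with product weight `(1+|x|)^{-α}(1+|y|)^{-β}`. -/
def Rab (α β : ℝ) (F : ℝ → ℂ) (x y : ℝ) : ℂ :=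
  Rext F x y * Complex.ofReal ((1 + |x|) ^ (-α) * (1 + |y|) ^ (-β))

/-- Weighted extension operator with weight `(1+|x|+|y|)^{-γ}`. -/
def Rgamma (γ : ℝ) (F : ℝ → ℂ) (x y : ℝ) : ℂ :=
  Rext F x y * Complex.ofReal ((1 + |x| + |y|) ^ (-γ))

/-- `L^r` norm on the circle, parametrized by `[0, 2π]`. -/
def circleLp (r : ℝ≥0∞) (F : ℝ → ℂ) : ℝ≥0∞ :=
  eLpNorm F r (volume.restrict (Ioc (0:ℝ) (2 * π)))

/-- `L^q` quasinorm on the plane. -/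
def planeLp (q : ℝ≥0∞) (g : ℝ × ℝ → ℂ) : ℝ≥0∞ :=
  eLpNorm g q (volume : Measure (ℝ × ℝ))

/-- Weak `L^q` quasinorm on the line. -/
def wline (q : ℝ) (g : ℝ → ℂ) : ℝ≥0∞ :=
  ⨆ (t : ℝ) (_ : 0 < t), ENNReal.ofReal t * (volume {x : ℝ | t < ‖g x‖}) ^ (1 / q)

/-- Weak `L^q` quasinorm on the line, for `ℝ≥0∞`-valued functions. -/
def wlineE (q : ℝ) (g : ℝ → ℝ≥0∞) : ℝ≥0∞ :=
  ⨆ (t : ℝ) (_ : 0 < t), ENNReal.ofReal t * (volume {x : ℝ | ENNReal.ofReal t < g x}) ^ (1 / q)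

/-- Mixed weak quasinorm `L^{q,∞}_x(L^{q,∞}_y)`. -/
def mixedXY (q : ℝ) (g : ℝ × ℝ → ℂ) : ℝ≥0∞ :=
  wlineE q fun x => wline q fun y => g (x, y)

/-- Mixed weak quasinorm `L^{q,∞}_y(L^{q,∞}_x)`. -/
def mixedYX (q : ℝ) (g : ℝ × ℝ → ℂ) : ℝ≥0∞ :=
  wlineE q fun y => wline q fun x => g (x, y)

/-- Weak `L^q` quasinorm on the plane. -/
def wplane (q : ℝ) (g : ℝ × ℝ → ℂ) : ℝ≥0∞ :=
  ⨆ (t : ℝ) (_ : 0 < t), ENNReal.ofReal t * (volume {p : ℝ × ℝ | t < ‖g p‖}) ^ (1 / q)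

/-- Lorentz `L^{r,1}` norm on the circle. -/
def lorentz1 (r : ℝ) (F : ℝ → ℂ) : ℝ≥0∞ :=
  ∫⁻ t in Ioi (0:ℝ), (volume {φ ∈ Icc (0:ℝ) (2 * π) | t < ‖F φ‖}) ^ (1 / r)

/-- Weak `L^r` quasinorm on the circle. -/
def wcircle (r : ℝ) (F : ℝ → ℂ) : ℝ≥0∞ :=
  ⨆ (t : ℝ) (_ : 0 < t), ENNReal.ofReal t * (volume {φ ∈ Icc (0:ℝ) (2 * π) | t < ‖F φ‖}) ^ (1 / r)

lemma xx_amgm (a b s t : ℝ≥0∞) (hs : s ≠ 0) (hs' : s ≠ ⊤) (ht : t ≠ 0) (ht' : t ≠ ⊤) :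
    2 * (a * b) ≤ a ^ 2 / s * t + b ^ 2 / t * s := by
  by_cases ha : a = ⊤
  · subst ha
    by_cases hb : b = 0
    · simp [hb]
    · have : (⊤ : ℝ≥0∞) ^ 2 / s * t = ⊤ := by
        rw [ENNReal.top_pow two_ne_zero, ENNReal.top_div_of_ne_top hs', ENNReal.top_mul ht]
      rw [this]; simp
  by_cases hb : b = ⊤
  · subst hb
    have : (⊤ : ℝ≥0∞) ^ 2 / t * s = ⊤ := by
        rw [ENNReal.top_pow two_ne_zero, ENNReal.top_div_of_ne_top ht', ENNReal.top_mul hs]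
    rw [this]; simp
  lift a to NNReal using ha
  lift b to NNReal using hb
  lift s to NNReal using hs'
  lift t to NNReal using ht'
  have hs0 : s ≠ 0 := by simpa using hs
  have ht0 : t ≠ 0 := by simpa using ht
  norm_cast
  rw [← NNReal.coe_le_coe]
  push_cast
  have hs1 : (0:ℝ) < s := by positivity
  have ht1 : (0:ℝ) < t := by positivity
  have : (a:ℝ) ^ 2 / s * t + b ^ 2 / t * s - 2 * (a * b) = (a * t - b * s) ^ 2 / (s * t) := by
    field_simp
    ring
  have h2 : 0 ≤ ((a:ℝ) * t - b * s) ^ 2 / (s * t) := by positivity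
  linarith

lemma schur {Y Z : Type*} [MeasurableSpace Y] [MeasurableSpace Z] (ν : Measure Y)
    [IsFiniteMeasure ν] (μ : Measure Z) [IsFiniteMeasure μ] (e : Y → Z → ℂ)
    (he : Measurable (Function.uncurry e)) (he1 : ∀ y z, ‖e y z‖ ≤ 1)
    (g : Z → ℂ) (hg : Measurable g) (M : ℝ) (hgM : ∀ z, ‖g z‖ ≤ M)
    (m : Z → ℝ) (hm : Measurable m) (hmpos : ∀ᵐ z ∂μ, 0 < m z)
    (K : Z → Z → ℝ≥0∞) (hK : Measurable (Function.uncurry K)) (hKs : ∀ z z', K z z' = K z' z)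
    (hKe : ∀ z z', ‖∫ y, e y z * (starRingEnd ℂ) (e y z') ∂ν‖ₑ ≤ K z z') (A : ℝ≥0∞)
    (hA : ∀ z, ∫⁻ z', ENNReal.ofReal (m z') * K z z' ∂μ ≤ A) :
    ∫⁻ y, ‖∫ z, g z * e y z ∂μ‖ₑ ^ 2 ∂ν ≤ A * ∫⁻ z, ‖g z‖ₑ ^ 2 / ENNReal.ofReal (m z) ∂μ := by
  have hM : 0 ≤ M ∨ IsEmpty Z := by
    by_cases h : Nonempty Z
    · obtain ⟨z⟩ := h
      exact Or.inl ((norm_nonneg _).trans (hgM z))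
    · exact Or.inr (not_nonempty_iff.mp h)
  rcases hM with hM | hZ
  swap
  · simp [Measure.eq_zero_of_isEmpty μ]
  have hsm : StronglyMeasurable (fun y => ∫ z, g z * e y z ∂μ) := by
    have : StronglyMeasurable (Function.uncurry (fun y z => g z * e y z)) :=
      ((hg.comp measurable_snd).mul he).stronglyMeasurable
    exact this.integral_prod_right
  have hbd : ∀ y, ‖∫ z, g z * e y z ∂μ‖ ≤ M * μ.real univ := by
    intro y
    apply norm_integral_le_of_norm_le_const
    filter_upwards with z
    rw [norm_mul]
    calc _ ≤ M * 1 := mul_le_mul (hgM z) (he1 y z) (norm_nonneg _) hM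
      _ = M := mul_one M
  -- step 1
  let H : Y → Z × Z → ℂ := fun y p => (g p.1 * e y p.1) * (starRingEnd ℂ) (g p.2 * e y p.2)
  have hHm : Measurable (Function.uncurry H) := by
    have h1 : Measurable (fun q : Y × (Z × Z) => g q.2.1 * e q.1 q.2.1) :=
      (hg.comp (measurable_fst.comp measurable_snd)).mul
        (he.comp (measurable_fst.prodMk (measurable_fst.comp measurable_snd)))
    have h2 : Measurable (fun q : Y × (Z × Z) => g q.2.2 * e q.1 q.2.2) :=
      (hg.comp (measurable_snd.comp measurable_snd)).mul
        (he.comp (measurable_fst.prodMk (measurable_snd.comp measurable_snd)))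
    exact h1.mul (Complex.continuous_conj.measurable.comp h2)
  have hHb : ∀ y p, ‖H y p‖ ≤ M * M := by
    intro y p
    simp only [H, norm_mul, RCLike.norm_conj]
    have h3 : ∀ z, ‖g z‖ * ‖e y z‖ ≤ M := fun z => by
      calc _ ≤ M * 1 := mul_le_mul (hgM z) (he1 y z) (norm_nonneg _) hM
        _ = M := mul_one M
    exact mul_le_mul (h3 _) (h3 _) (by positivity) hM
  have hHint : Integrable (Function.uncurry H) (ν.prod (μ.prod μ)) := by
    apply Integrable.of_bound hHm.aestronglyMeasurable (M * M)
    filter_upwards with q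
    exact hHb q.1 q.2
  have hsq : ∀ y, ((‖∫ z, g z * e y z ∂μ‖ ^ 2 : ℝ) : ℂ) = ∫ p, H y p ∂(μ.prod μ) := by
    intro y
    simp only [H]
    rw [integral_prod_mul (fun z => g z * e y z) (fun z => (starRingEnd ℂ) (g z * e y z)),
      integral_conj, Complex.mul_conj, Complex.normSq_eq_norm_sq]
  have h1 : ∫⁻ y, ‖∫ z, g z * e y z ∂μ‖ₑ ^ 2 ∂ν
      = ENNReal.ofReal (∫ y, ‖∫ z, g z * e y z ∂μ‖ ^ 2 ∂ν) := by
    rw [ofReal_integral_eq_lintegral_ofReal]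
    · apply lintegral_congr
      intro y
      rw [ENNReal.ofReal_pow (norm_nonneg _), ofReal_norm]
    · apply Integrable.of_bound (hsm.norm.pow 2).aestronglyMeasurable ((M * μ.real univ) ^ 2)
      filter_upwards with y
      rw [Real.norm_eq_abs, abs_of_nonneg (sq_nonneg _)]
      exact pow_le_pow_left₀ (norm_nonneg _) (hbd y) 2
    · filter_upwards with y
      positivity
  have h2 : ENNReal.ofReal (∫ y, ‖∫ z, g z * e y z ∂μ‖ ^ 2 ∂ν)
      ≤ ∫⁻ p, ‖∫ y, H y p ∂ν‖ₑ ∂(μ.prod μ) := by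
    have h3 : ((∫ y, ‖∫ z, g z * e y z ∂μ‖ ^ 2 ∂ν : ℝ) : ℂ) = ∫ p, ∫ y, H y p ∂ν ∂(μ.prod μ) := by
      rw [← integral_integral_swap hHint, ← integral_complex_ofReal]
      apply integral_congr_ae
      filter_upwards with y
      exact hsq y
    have h4 : ENNReal.ofReal (∫ y, ‖∫ z, g z * e y z ∂μ‖ ^ 2 ∂ν) ≤
        ‖((∫ y, ‖∫ z, g z * e y z ∂μ‖ ^ 2 ∂ν : ℝ) : ℂ)‖ₑ := by
      rw [← ofReal_norm]
      apply ENNReal.ofReal_le_ofReal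
      rw [Complex.norm_real]
      exact le_abs_self _
    refine h4.trans ?_
    rw [h3]
    exact enorm_integral_le_lintegral_enorm _
  have h5 : ∀ p : Z × Z, ‖∫ y, H y p ∂ν‖ₑ ≤ ‖g p.1‖ₑ * ‖g p.2‖ₑ * K p.1 p.2 := by
    intro p
    have : ∫ y, H y p ∂ν = (g p.1 * (starRingEnd ℂ) (g p.2)) *
        ∫ y, e y p.1 * (starRingEnd ℂ) (e y p.2) ∂ν := by
      rw [← integral_const_mul]
      congr 1
      ext y
      simp only [H, map_mul]
      ring
    rw [this, enorm_mul, enorm_mul]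
    have hc : ‖(starRingEnd ℂ) (g p.2)‖ₑ = ‖g p.2‖ₑ := by
      rw [← ofReal_norm, ← ofReal_norm, RCLike.norm_conj]
    rw [hc]
    gcongr
    exact hKe _ _
  have h6 : ∫⁻ p, ‖∫ y, H y p ∂ν‖ₑ ∂(μ.prod μ) ≤
      ∫⁻ z, ∫⁻ z', ‖g z‖ₑ * ‖g z'‖ₑ * K z z' ∂μ ∂μ := by
    refine (lintegral_mono h5).trans ?_
    rw [lintegral_prod]
    apply Measurable.aemeasurable
    exact ((hg.comp measurable_fst).enorm.mul (hg.comp measurable_snd).enorm).mul hK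
  have hgd : Measurable (fun z => ‖g z‖ₑ ^ 2 / ENNReal.ofReal (m z)) :=
    (hg.enorm.pow_const 2).div hm.ennreal_ofReal
  set B := ∫⁻ z, ‖g z‖ₑ ^ 2 / ENNReal.ofReal (m z) ∂μ with hB
  have hKz : ∀ z, Measurable (K z) := fun z => hK.of_uncurry_left
  have h7 : 2 * ∫⁻ z, ∫⁻ z', ‖g z‖ₑ * ‖g z'‖ₑ * K z z' ∂μ ∂μ ≤
      ∫⁻ z, ∫⁻ z', (‖g z‖ₑ ^ 2 / ENNReal.ofReal (m z)) * (ENNReal.ofReal (m z') * K z z') ∂μ ∂μ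
      + ∫⁻ z, ∫⁻ z', (‖g z'‖ₑ ^ 2 / ENNReal.ofReal (m z')) * (ENNReal.ofReal (m z) * K z z')
        ∂μ ∂μ := by
    have m1 : Measurable (Function.uncurry fun z z' => (‖g z‖ₑ ^ 2 / ENNReal.ofReal (m z)) *
      (ENNReal.ofReal (m z') * K z z')) :=
      (hgd.comp measurable_fst).mul ((hm.ennreal_ofReal.comp measurable_snd).mul hK)
    have m2 : Measurable (fun z => ∫⁻ z', (‖g z‖ₑ ^ 2 / ENNReal.ofReal (m z)) *
      (ENNReal.ofReal (m z') * K z z') ∂μ) := m1.lintegral_prod_right'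
    rw [← lintegral_const_mul' _ _ (by simp), ← lintegral_add_left m2]
    apply lintegral_mono_ae
    filter_upwards [hmpos] with z hz
    rw [← lintegral_const_mul' _ _ (by simp), ← lintegral_add_left]
    · apply lintegral_mono_ae
      filter_upwards [hmpos] with z' hz'
      have := xx_amgm ‖g z‖ₑ ‖g z'‖ₑ (ENNReal.ofReal (m z)) (ENNReal.ofReal (m z'))
        (by simpa using hz) (by simp) (by simpa using hz') (by simp)
      calc _ = 2 * (‖g z‖ₑ * ‖g z'‖ₑ) * K z z' := by ring
        _ ≤ _ := mul_le_mul_left this _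
        _ = _ := by ring
    · exact measurable_const.mul (hm.ennreal_ofReal.mul (hKz z))
  have h8 : ∫⁻ z, ∫⁻ z', (‖g z‖ₑ ^ 2 / ENNReal.ofReal (m z)) * (ENNReal.ofReal (m z') * K z z')
      ∂μ ∂μ ≤ A * B := by
    rw [hB, ← lintegral_const_mul _ hgd]
    apply lintegral_mono
    intro z
    dsimp only
    rw [lintegral_const_mul]
    · rw [mul_comm]
      exact mul_le_mul_left (hA z) _
    · exact hm.ennreal_ofReal.mul (hKz z)
  have h9 : ∫⁻ z, ∫⁻ z', (‖g z'‖ₑ ^ 2 / ENNReal.ofReal (m z')) * (ENNReal.ofReal (m z) * K z z')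
      ∂μ ∂μ ≤ A * B := by
    rw [lintegral_lintegral_swap]
    · refine le_trans (le_of_eq ?_) h8
      apply lintegral_congr
      intro z
      apply lintegral_congr
      intro z'
      rw [hKs]
    · exact ((hgd.comp measurable_snd).mul
        ((hm.ennreal_ofReal.comp measurable_fst).mul hK)).aemeasurable
  rw [h1]
  refine (h2.trans h6).trans ?_
  have h10 := h7.trans (add_le_add h8 h9)
  rw [← two_mul] at h10
  rwa [ENNReal.mul_le_mul_iff_right (by simp) (by simp)] at h10

def gnu (δ : ℝ) : Measure ℝ := volume.withDensity (fun y => ENNReal.ofReal (Real.exp (-δ * y ^ 2)))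

def kern (δ t : ℝ) : ℝ := √(π / δ) * Real.exp (-t ^ 2 / (4 * δ))

lemma kern_nonneg (δ t : ℝ) : 0 ≤ kern δ t := by unfold kern; positivity

lemma kern_meas (δ : ℝ) : Measurable (kern δ) := by
  unfold kern
  fun_prop

lemma kern_neg (δ t : ℝ) : kern δ (-t) = kern δ t := by simp [kern]

lemma kern_symm (δ s t : ℝ) : kern δ (s - t) = kern δ (t - s) := by
  rw [← kern_neg, neg_sub]

lemma gdens_meas (δ : ℝ) : Measurable (fun y : ℝ => ENNReal.ofReal (Real.exp (-δ * y ^ 2))) := by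
  fun_prop

lemma gnu_finite {δ : ℝ} (hδ : 0 < δ) : IsFiniteMeasure (gnu δ) := by
  apply isFiniteMeasure_withDensity_ofReal
  exact (integrable_exp_neg_mul_sq hδ).2

lemma gnu_fourier {δ : ℝ} (hδ : 0 < δ) (t : ℝ) :
    ∫ y, Complex.exp (Complex.I * ((y * t : ℝ) : ℂ)) ∂(gnu δ) = (kern δ t : ℂ) := by
  unfold gnu
  rw [integral_withDensity_eq_integral_toReal_smul (gdens_meas δ)
    (by filter_upwards with y; simp)]
  have h := fourierIntegral_gaussian (b := (δ : ℂ)) (by simpa using hδ) (t : ℂ)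
  have h2 : ((π : ℂ) / (δ : ℂ)) ^ (1 / 2 : ℂ) * Complex.exp (-(t:ℂ) ^ 2 / (4 * (δ : ℂ)))
      = (kern δ t : ℂ) := by
    unfold kern
    rw [Real.sqrt_eq_rpow]
    push_cast
    rw [Complex.ofReal_cpow (by positivity)]
    push_cast
    rfl
  rw [← h2, ← h]
  congr 1
  ext y
  rw [ENNReal.toReal_ofReal (by positivity)]
  rw [Complex.real_smul]
  push_cast
  rw [mul_comm]
  congr 2
  ring

lemma kern_lint {δ : ℝ} (hδ : 0 < δ) (c : ℝ) :
    ∫⁻ u, ENNReal.ofReal (kern δ (c - u)) = ENNReal.ofReal (2 * π) := by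
  have h0 : ∫⁻ u, ENNReal.ofReal (kern δ (c - u)) = ∫⁻ u, ENNReal.ofReal (kern δ u) := by
    rw [lintegral_sub_left_eq_self (fun u => ENNReal.ofReal (kern δ u)) c]
  rw [h0, ← ofReal_integral_eq_lintegral_ofReal]
  · congr 1
    unfold kern
    rw [integral_const_mul]
    have : ∀ u : ℝ, Real.exp (-u ^ 2 / (4 * δ)) = Real.exp (-(1 / (4 * δ)) * u ^ 2) := by
      intro u
      congr 1
      field_simp
    simp_rw [this]
    rw [integral_gaussian, ← Real.sqrt_mul (by positivity)]
    have : π / δ * (π / (1 / (4 * δ))) = (2 * π) ^ 2 := by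
      field_simp
      ring
    rw [this, Real.sqrt_sq (by positivity)]
  · unfold kern
    apply Integrable.const_mul
    have : ∀ u : ℝ, Real.exp (-u ^ 2 / (4 * δ)) = Real.exp (-(1 / (4 * δ)) * u ^ 2) := by
      intro u
      congr 1
      field_simp
    simp_rw [this]
    exact integrable_exp_neg_mul_sq (by positivity)
  · filter_upwards with u
    exact kern_nonneg _ _

lemma gauss_limit : Tendsto (fun n : ℕ => 1 / ((n : ℝ) + 1)) atTop (nhds 0) :=
  tendsto_one_div_add_atTop_nhds_zero_nat

lemma gdens_tendsto (y : ℝ) : Tendsto (fun n : ℕ =>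
    ENNReal.ofReal (Real.exp (-(1 / ((n : ℝ) + 1)) * y ^ 2))) atTop (nhds 1) := by
  have h1 : Tendsto (fun n : ℕ => Real.exp (-(1 / ((n : ℝ) + 1)) * y ^ 2)) atTop
      (nhds (Real.exp (-0 * y ^ 2))) :=
    (Real.continuous_exp.tendsto _).comp ((gauss_limit.neg).mul_const _)
  have h2 := ENNReal.tendsto_ofReal h1
  simpa using h2

lemma gnu_fatou (g : ℝ → ℝ≥0∞) (hg : Measurable g) (A : ℝ≥0∞)
    (h : ∀ δ : ℝ, 0 < δ → ∫⁻ y, g y ∂(gnu δ) ≤ A) : ∫⁻ y, g y ≤ A := by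
  have h1 : ∀ y, Tendsto (fun n : ℕ =>
      ENNReal.ofReal (Real.exp (-(1 / ((n : ℝ) + 1)) * y ^ 2)) * g y) atTop (nhds (g y)) := by
    intro y
    have := ENNReal.Tendsto.mul_const (b := g y) (gdens_tendsto y) (Or.inl one_ne_zero)
    simpa using this
  calc ∫⁻ y, g y = ∫⁻ y, liminf (fun n : ℕ =>
      ENNReal.ofReal (Real.exp (-(1 / ((n : ℝ) + 1)) * y ^ 2)) * g y) atTop := by
        apply lintegral_congr
        intro y
        exact (h1 y).liminf_eq.symm
    _ ≤ liminf (fun n : ℕ => ∫⁻ y,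
      ENNReal.ofReal (Real.exp (-(1 / ((n : ℝ) + 1)) * y ^ 2)) * g y) atTop :=
        lintegral_liminf_le (fun n => (gdens_meas _).mul hg)
    _ ≤ liminf (fun n : ℕ => A) atTop := by
        refine liminf_le_liminf ?_
        filter_upwards with n
        have := h (1 / ((n : ℝ) + 1)) (by positivity)
        unfold gnu at this
        rwa [lintegral_withDensity_eq_lintegral_mul _ (gdens_meas _) hg] at this
    _ = A := by simp

lemma gnu_fatou2 (g : ℝ × ℝ → ℝ≥0∞) (hg : Measurable g) (A : ℝ≥0∞)
    (h : ∀ δ : ℝ, 0 < δ → ∫⁻ y, g y ∂((gnu δ).prod (gnu δ)) ≤ A) : ∫⁻ y, g y ≤ A := by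
  have h1 : ∀ y : ℝ × ℝ, Tendsto (fun n : ℕ =>
      (ENNReal.ofReal (Real.exp (-(1 / ((n : ℝ) + 1)) * y.1 ^ 2)) *
      ENNReal.ofReal (Real.exp (-(1 / ((n : ℝ) + 1)) * y.2 ^ 2))) * g y) atTop (nhds (g y)) := by
    intro y
    have h0 := ENNReal.Tendsto.mul (gdens_tendsto y.1) (Or.inl one_ne_zero) (gdens_tendsto y.2)
      (Or.inl one_ne_zero)
    have := ENNReal.Tendsto.mul_const (b := g y) h0 (Or.inl (by simp))
    simpa using this
  have hm : ∀ δ : ℝ, Measurable (fun y : ℝ × ℝ => ENNReal.ofReal (Real.exp (-δ * y.1 ^ 2)) *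
      ENNReal.ofReal (Real.exp (-δ * y.2 ^ 2))) := fun δ => by fun_prop
  calc ∫⁻ y, g y = ∫⁻ y : ℝ × ℝ, liminf (fun n : ℕ =>
      (ENNReal.ofReal (Real.exp (-(1 / ((n : ℝ) + 1)) * y.1 ^ 2)) *
      ENNReal.ofReal (Real.exp (-(1 / ((n : ℝ) + 1)) * y.2 ^ 2))) * g y) atTop := by
        apply lintegral_congr
        intro y
        exact (h1 y).liminf_eq.symm
    _ ≤ liminf (fun n : ℕ => ∫⁻ y : ℝ × ℝ,
      (ENNReal.ofReal (Real.exp (-(1 / ((n : ℝ) + 1)) * y.1 ^ 2)) *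
      ENNReal.ofReal (Real.exp (-(1 / ((n : ℝ) + 1)) * y.2 ^ 2))) * g y) atTop :=
        lintegral_liminf_le (fun n => (hm _).mul hg)
    _ ≤ liminf (fun n : ℕ => A) atTop := by
        refine liminf_le_liminf ?_
        filter_upwards with n
        have := h (1 / ((n : ℝ) + 1)) (by positivity)
        unfold gnu at this
        rw [prod_withDensity (gdens_meas _) (gdens_meas _), ← Measure.volume_eq_prod] at this
        rwa [lintegral_withDensity_eq_lintegral_mul _ (hm _) hg] at this
    _ = A := by simp

/-- The unimodular exponential. -/
def ep (t : ℝ) : ℂ := Complex.exp (Complex.I * (t : ℂ))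

lemma ep_norm (t : ℝ) : ‖ep t‖ = 1 := by
  unfold ep
  rw [mul_comm]
  exact Complex.norm_exp_ofReal_mul_I t

lemma ep_cont : Continuous ep := by unfold ep; fun_prop

lemma ep_add (s t : ℝ) : ep (s + t) = ep s * ep t := by
  unfold ep
  rw [← Complex.exp_add]
  push_cast
  ring_nf

lemma ep_conj (t : ℝ) : (starRingEnd ℂ) (ep t) = ep (-t) := by
  unfold ep
  rw [← Complex.exp_conj]
  simp

lemma ep_meas {Z : Type*} [MeasurableSpace Z] {f : Z → ℝ} (hf : Measurable f) :
    Measurable (fun z => ep (f z)) := ep_cont.measurable.comp hf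

lemma gnu_ep {δ : ℝ} (hδ : 0 < δ) (s t : ℝ) :
    ∫ y, ep (y * s) * (starRingEnd ℂ) (ep (y * t)) ∂(gnu δ) = (kern δ (s - t) : ℂ) := by
  rw [← gnu_fourier hδ]
  congr 1
  ext y
  rw [ep_conj, ← ep_add]
  unfold ep
  congr 3
  ring

lemma plan1 {Z : Type*} [MeasurableSpace Z] (μ : Measure Z) [IsFiniteMeasure μ]
    (Φ : Z → ℝ) (hΦ : Measurable Φ)
    (g : Z → ℂ) (hg : Measurable g) (M : ℝ) (hgM : ∀ z, ‖g z‖ ≤ M)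
    (m : Z → ℝ) (hm : Measurable m) (hmpos : ∀ᵐ z ∂μ, 0 < m z) (A : ℝ≥0∞)
    (hA : ∀ δ : ℝ, 0 < δ → ∀ c, ∫⁻ z, ENNReal.ofReal (m z) * ENNReal.ofReal (kern δ (c - Φ z)) ∂μ
      ≤ A) :
    ∫⁻ y : ℝ, ‖∫ z, g z * ep (y * Φ z) ∂μ‖ₑ ^ 2 ≤
      A * ∫⁻ z, ‖g z‖ₑ ^ 2 / ENNReal.ofReal (m z) ∂μ := by
  have hem : Measurable (Function.uncurry (fun (y : ℝ) (z : Z) => ep (y * Φ z))) :=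
    ep_meas (measurable_fst.mul (hΦ.comp measurable_snd))
  apply gnu_fatou
  · have : StronglyMeasurable (Function.uncurry (fun (y : ℝ) z => g z * ep (y * Φ z))) :=
      ((hg.comp measurable_snd).mul hem).stronglyMeasurable
    exact (this.integral_prod_right.measurable.enorm).pow_const 2
  intro δ hδ
  have := gnu_finite hδ
  refine schur (gnu δ) μ (fun y z => ep (y * Φ z)) hem (fun y z => (ep_norm _).le) g hg M hgM m hm
    hmpos (fun z z' => ENNReal.ofReal (kern δ (Φ z - Φ z'))) ?_ ?_ ?_ A ?_
  · exact ((kern_meas δ).comp ((hΦ.comp measurable_fst).sub (hΦ.comp measurable_snd))).ennreal_ofReal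
  · intro z z'
    rw [kern_symm]
  · intro z z'
    rw [gnu_ep hδ, ← ofReal_norm, Complex.norm_real, Real.norm_of_nonneg (kern_nonneg _ _)]
  · intro z
    exact hA δ hδ (Φ z)

lemma plan2 {Z : Type*} [MeasurableSpace Z] (μ : Measure Z) [IsFiniteMeasure μ]
    (Φ Ψ : Z → ℝ) (hΦ : Measurable Φ) (hΨ : Measurable Ψ)
    (g : Z → ℂ) (hg : Measurable g) (M : ℝ) (hgM : ∀ z, ‖g z‖ ≤ M)
    (m : Z → ℝ) (hm : Measurable m) (hmpos : ∀ᵐ z ∂μ, 0 < m z) (A : ℝ≥0∞)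
    (hA : ∀ δ : ℝ, 0 < δ → ∀ c d, ∫⁻ z, ENNReal.ofReal (m z) *
      (ENNReal.ofReal (kern δ (c - Φ z)) * ENNReal.ofReal (kern δ (d - Ψ z))) ∂μ ≤ A) :
    ∫⁻ y : ℝ × ℝ, ‖∫ z, g z * ep (y.1 * Φ z + y.2 * Ψ z) ∂μ‖ₑ ^ 2 ≤
      A * ∫⁻ z, ‖g z‖ₑ ^ 2 / ENNReal.ofReal (m z) ∂μ := by
  have hem : Measurable (Function.uncurry (fun (y : ℝ × ℝ) (z : Z) =>
      ep (y.1 * Φ z + y.2 * Ψ z))) :=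
    ep_meas (((measurable_fst.comp measurable_fst).mul (hΦ.comp measurable_snd)).add
      ((measurable_snd.comp measurable_fst).mul (hΨ.comp measurable_snd)))
  apply gnu_fatou2
  · have : StronglyMeasurable (Function.uncurry (fun (y : ℝ × ℝ) z =>
        g z * ep (y.1 * Φ z + y.2 * Ψ z))) :=
      ((hg.comp measurable_snd).mul hem).stronglyMeasurable
    exact (this.integral_prod_right.measurable.enorm).pow_const 2
  intro δ hδ
  have := gnu_finite hδ
  refine schur ((gnu δ).prod (gnu δ)) μ (fun y z => ep (y.1 * Φ z + y.2 * Ψ z)) hem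
    (fun y z => (ep_norm _).le) g hg M hgM m hm
    hmpos (fun z z' => ENNReal.ofReal (kern δ (Φ z - Φ z')) *
      ENNReal.ofReal (kern δ (Ψ z - Ψ z'))) ?_ ?_ ?_ A ?_
  · exact ((kern_meas δ).comp
      ((hΦ.comp measurable_fst).sub (hΦ.comp measurable_snd))).ennreal_ofReal.mul
      ((kern_meas δ).comp ((hΨ.comp measurable_fst).sub (hΨ.comp measurable_snd))).ennreal_ofReal
  · intro z z'
    rw [kern_symm, kern_symm δ (Ψ z)]
  · intro z z'
    have h1 : ∀ y : ℝ × ℝ, ep (y.1 * Φ z + y.2 * Ψ z) *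
        (starRingEnd ℂ) (ep (y.1 * Φ z' + y.2 * Ψ z')) =
        (ep (y.1 * Φ z) * (starRingEnd ℂ) (ep (y.1 * Φ z'))) *
        (ep (y.2 * Ψ z) * (starRingEnd ℂ) (ep (y.2 * Ψ z'))) := by
      intro y
      rw [ep_add, ep_add, map_mul]
      ring
    simp_rw [h1]
    rw [integral_prod_mul (fun y => ep (y * Φ z) * (starRingEnd ℂ) (ep (y * Φ z')))
      (fun y => ep (y * Ψ z) * (starRingEnd ℂ) (ep (y * Ψ z'))), gnu_ep hδ, gnu_ep hδ, enorm_mul,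
      ← ofReal_norm, Complex.norm_real, Real.norm_of_nonneg (kern_nonneg _ _),
      ← ofReal_norm, Complex.norm_real, Real.norm_of_nonneg (kern_nonneg _ _)]
  · intro z
    exact hA δ hδ (Φ z) (Ψ z)

/-- The arc. -/
def arc : Set ℝ := Ioc (-(π / 4)) (π / 4)

/-- one-dimensional change of variables -/
lemma cov1 {δ : ℝ} (hδ : 0 < δ) (c : ℝ) (Φ Φ' : ℝ → ℝ) (s : Set ℝ) (hs : MeasurableSet s)
    (hd : ∀ x ∈ s, HasDerivWithinAt Φ (Φ' x) s x) (hi : InjOn Φ s) :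
    ∫⁻ z in s, ENNReal.ofReal |Φ' z| * ENNReal.ofReal (kern δ (c - Φ z)) ≤
      ENNReal.ofReal (2 * π) := by
  rw [← lintegral_image_eq_lintegral_abs_deriv_mul hs hd hi
    (fun u => ENNReal.ofReal (kern δ (c - u))), ← kern_lint hδ c]
  exact setLIntegral_le_lintegral _ _

/-- two-dimensional change of variables -/
lemma cov2 {δ : ℝ} (hδ : 0 < δ) (c d : ℝ) (f : ℝ × ℝ → ℝ × ℝ) (f' : ℝ × ℝ → ℝ × ℝ →L[ℝ] ℝ × ℝ)
    (s : Set (ℝ × ℝ)) (hs : MeasurableSet s)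
    (hd : ∀ x ∈ s, HasFDerivWithinAt f (f' x) s x) (hi : InjOn f s) :
    ∫⁻ z in s, ENNReal.ofReal |(f' z).det| * (ENNReal.ofReal (kern δ (c - (f z).1)) *
      ENNReal.ofReal (kern δ (d - (f z).2))) ≤ ENNReal.ofReal (2 * π) * ENNReal.ofReal (2 * π) := by
  rw [← lintegral_image_eq_lintegral_abs_det_fderiv_mul volume hs hd hi
    (fun u => ENNReal.ofReal (kern δ (c - u.1)) * ENNReal.ofReal (kern δ (d - u.2)))]
  refine (setLIntegral_le_lintegral _ _).trans (le_of_eq ?_)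
  have h1 : ∀ c : ℝ, Measurable (fun u => ENNReal.ofReal (kern δ (c - u))) := fun c =>
    ((kern_meas δ).comp (measurable_const.sub measurable_id)).ennreal_ofReal
  rw [Measure.volume_eq_prod, lintegral_prod_mul (h1 c).aemeasurable (h1 d).aemeasurable,
    kern_lint hδ, kern_lint hδ]

lemma arc_meas : MeasurableSet arc := measurableSet_Ioc

lemma arc_mem_half {z : ℝ} (hz : z ∈ arc) : z ∈ Icc (-(π / 2)) (π / 2) := by
  obtain ⟨h1, h2⟩ := hz
  have := pi_pos
  constructor <;> linarith

lemma ker_c {δ : ℝ} (hδ : 0 < δ) (c : ℝ) :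
    ∫⁻ z in arc, ENNReal.ofReal (1 / 2) * ENNReal.ofReal (kern δ (c - sin z)) ≤
      ENNReal.ofReal (2 * π) := by
  refine le_trans ?_ (cov1 hδ c sin cos arc arc_meas
    (fun x _ => (hasDerivAt_sin x).hasDerivWithinAt)
    (fun x hx y hy h => injOn_sin (arc_mem_half hx) (arc_mem_half hy) h))
  apply setLIntegral_mono_ae' arc_meas
  filter_upwards with z hz
  gcongr
  refine le_trans ?_ (le_abs_self _)
  have hpi := pi_pos
  have h3 : cos (π / 3) ≤ cos |z| := by
    apply cos_le_cos_of_nonneg_of_le_pi (abs_nonneg _) (by linarith)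
    rw [abs_le]
    exact ⟨by linarith [hz.1], by linarith [hz.2]⟩
  rw [cos_abs, cos_pi_div_three] at h3
  exact h3

lemma ker_d {δ : ℝ} (hδ : 0 < δ) (c : ℝ) :
    ∫⁻ z in arc, ENNReal.ofReal |sin z| * ENNReal.ofReal (kern δ (c - cos z)) ≤
      2 * ENNReal.ofReal (2 * π) := by
  have hpi := pi_pos
  have h1 := cov1 hδ c cos (fun z => -sin z) (Icc 0 (π / 4)) measurableSet_Icc
    (fun x _ => (hasDerivAt_cos x).hasDerivWithinAt)
    (fun x hx y hy h => injOn_cos ⟨hx.1, by linarith [hx.2]⟩ ⟨hy.1, by linarith [hy.2]⟩ h)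
  have h2 := cov1 hδ c cos (fun z => -sin z) (Icc (-(π / 4)) 0) measurableSet_Icc
    (fun x _ => (hasDerivAt_cos x).hasDerivWithinAt)
    (fun x hx y hy h => by
      have := injOn_cos (x₁ := -x) (x₂ := -y) ⟨by linarith [hx.2], by linarith [hx.1]⟩
        ⟨by linarith [hy.2], by linarith [hy.1]⟩ (by simpa using h)
      linarith)
  simp only [abs_neg] at h1 h2
  have hsub : arc ⊆ Icc 0 (π / 4) ∪ Icc (-(π / 4)) 0 := by
    intro z hz
    rcases le_total 0 z with h | h
    · exact Or.inl ⟨h, hz.2⟩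
    · exact Or.inr ⟨hz.1.le, h⟩
  refine (lintegral_mono_set hsub).trans ((lintegral_union_le _ _ _).trans ?_)
  rw [two_mul]
  exact add_le_add h1 h2

lemma inj_aux {a b a' b' : ℝ} (ha : a ∈ arc) (hb : b ∈ arc) (ha' : a' ∈ arc) (hb' : b' ∈ arc)
    (hab : a < b) (hab' : a' < b') (h1 : sin a + sin b = sin a' + sin b')
    (h2 : cos a + cos b = cos a' + cos b') : a = a' ∧ b = b' := by
  have hpi := pi_pos
  have h3 : cos (b - a) = cos (b' - a') := by
    rw [cos_sub, cos_sub]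
    have e1 := sin_sq_add_cos_sq a
    have e2 := sin_sq_add_cos_sq b
    have e3 := sin_sq_add_cos_sq a'
    have e4 := sin_sq_add_cos_sq b'
    have e5 : (sin a + sin b) ^ 2 = (sin a' + sin b') ^ 2 := by rw [h1]
    have e6 : (cos a + cos b) ^ 2 = (cos a' + cos b') ^ 2 := by rw [h2]
    linarith
  have h4 : b - a = b' - a' := by
    apply injOn_cos _ _ h3
    · exact ⟨by linarith, by linarith [ha.1, hb.2]⟩
    · exact ⟨by linarith, by linarith [ha'.1, hb'.2]⟩
  have key : ∀ a b a' b' : ℝ, a ∈ arc → b ∈ arc → a' ∈ arc → b' ∈ arc → b - a = b' - a' →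
      a < a' → sin a + sin b < sin a' + sin b' := by
    intro a b a' b' ha hb ha' hb' h h'
    exact add_lt_add (strictMonoOn_sin (arc_mem_half ha) (arc_mem_half ha') h')
      (strictMonoOn_sin (arc_mem_half hb) (arc_mem_half hb') (by linarith))
  rcases lt_trichotomy a a' with h | h | h
  · have := key a b a' b' ha hb ha' hb' h4 h
    linarith
  · exact ⟨h, by linarith⟩
  · have := key a' b' a b ha' hb' ha hb h4.symm h
    linarith

def sumMap (p : ℝ × ℝ) : ℝ × ℝ := (sin p.1 + sin p.2, cos p.1 + cos p.2)

def sumMap' (p : ℝ × ℝ) : ℝ × ℝ →L[ℝ] ℝ × ℝ :=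
  (Matrix.toLin (Module.Basis.finTwoProd ℝ) (Module.Basis.finTwoProd ℝ)
    !![cos p.1, cos p.2; -sin p.1, -sin p.2]).toContinuousLinearMap

lemma sumMap_deriv (p : ℝ × ℝ) : HasFDerivAt sumMap (sumMap' p) p := by
  unfold sumMap' sumMap
  rw [Matrix.toLin_finTwoProd_toContinuousLinearMap]
  have h1 : HasFDerivAt (fun p : ℝ × ℝ => p.1) (ContinuousLinearMap.fst ℝ ℝ ℝ) p := hasFDerivAt_fst
  have h2 : HasFDerivAt (fun p : ℝ × ℝ => p.2) (ContinuousLinearMap.snd ℝ ℝ ℝ) p := hasFDerivAt_snd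
  exact (h1.sin.add h2.sin).prodMk (h1.cos.add h2.cos)

lemma sumMap_det (p : ℝ × ℝ) : (sumMap' p).det = sin (p.1 - p.2) := by
  unfold sumMap'
  simp only [LinearMap.det_toContinuousLinearMap, LinearMap.det_toLin,
    Matrix.det_fin_two_of]
  rw [sin_sub]
  ring

lemma ker_b {δ : ℝ} (hδ : 0 < δ) (c d : ℝ) :
    ∫⁻ z in arc ×ˢ arc, ENNReal.ofReal |sin (z.1 - z.2)| *
      (ENNReal.ofReal (kern δ (c - (sin z.1 + sin z.2))) *
        ENNReal.ofReal (kern δ (d - (cos z.1 + cos z.2)))) ≤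
      2 * (ENNReal.ofReal (2 * π) * ENNReal.ofReal (2 * π)) := by
  have hm : MeasurableSet (arc ×ˢ arc) := arc_meas.prod arc_meas
  have hlt : MeasurableSet ((arc ×ˢ arc) ∩ {p : ℝ × ℝ | p.1 < p.2}) :=
    hm.inter (measurableSet_lt measurable_fst measurable_snd)
  have hgt : MeasurableSet ((arc ×ˢ arc) ∩ {p : ℝ × ℝ | p.2 < p.1}) :=
    hm.inter (measurableSet_lt measurable_snd measurable_fst)
  have heq : MeasurableSet ({p : ℝ × ℝ | p.2 = p.1}) :=
    measurableSet_eq_fun measurable_snd measurable_fst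
  have h1 := cov2 hδ c d sumMap sumMap' _ hlt (fun x _ => (sumMap_deriv x).hasFDerivWithinAt)
    (fun x hx y hy h => by
      simp only [sumMap, Prod.mk.injEq] at h
      exact Prod.ext_iff.mpr (inj_aux hx.1.1 hx.1.2 hy.1.1 hy.1.2 hx.2 hy.2 h.1 h.2))
  have h2 := cov2 hδ c d sumMap sumMap' _ hgt (fun x _ => (sumMap_deriv x).hasFDerivWithinAt)
    (fun x hx y hy h => by
      simp only [sumMap, Prod.mk.injEq] at h
      exact Prod.ext_iff.mpr ((inj_aux hx.1.2 hx.1.1 hy.1.2 hy.1.1 hx.2 hy.2 (by linarith [h.1])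
        (by linarith [h.2])).symm))
  simp only [sumMap_det, sumMap] at h1 h2
  have h3 : ∫⁻ z in {p : ℝ × ℝ | p.2 = p.1}, ENNReal.ofReal |sin (z.1 - z.2)| *
      (ENNReal.ofReal (kern δ (c - (sin z.1 + sin z.2))) *
        ENNReal.ofReal (kern δ (d - (cos z.1 + cos z.2)))) ≤ 0 := by
    refine (setLIntegral_mono_ae' heq (g := fun _ => 0) ?_).trans (by simp)
    filter_upwards with z hz
    have : z.1 - z.2 = 0 := sub_eq_zero.mpr (Eq.symm hz)
    simp [this]
  have hsub : arc ×ˢ arc ⊆ ((arc ×ˢ arc) ∩ {p : ℝ × ℝ | p.1 < p.2} ∪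
      (arc ×ˢ arc) ∩ {p : ℝ × ℝ | p.2 < p.1}) ∪ {p : ℝ × ℝ | p.2 = p.1} := by
    intro z hz
    rcases lt_trichotomy z.1 z.2 with h | h | h
    · exact Or.inl (Or.inl ⟨hz, h⟩)
    · exact Or.inr h.symm
    · exact Or.inl (Or.inr ⟨hz, h⟩)
  refine (lintegral_mono_set hsub).trans ((lintegral_union_le _ _ _).trans ?_)
  refine (add_le_add (lintegral_union_le _ _ _) h3).trans ?_
  rw [two_mul, add_zero]
  exact add_le_add h1 h2

lemma even_lint (φ : ℝ → ℝ≥0∞) :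
    ∫⁻ u, φ |u| = 2 * ∫⁻ u in Ioi (0:ℝ), φ u := by
  have h1 : ∫⁻ u in Ioi (0:ℝ), φ |u| = ∫⁻ u in Ioi (0:ℝ), φ u :=
    setLIntegral_congr_fun measurableSet_Ioi (fun u (hu : 0 < u) => by simp only [abs_of_pos hu])
  have h2 : ∫⁻ u in Iio (0:ℝ), φ |u| = ∫⁻ u in Ioi (0:ℝ), φ |u| := by
    have := (Measure.measurePreserving_neg (volume : Measure ℝ)).setLIntegral_comp_preimage_emb
      (MeasurableEquiv.neg ℝ).measurableEmbedding (fun u => φ |u|) (Ioi 0)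
    rw [← this]
    simp
  rw [← lintegral_add_compl _ (measurableSet_Ioi (a := (0:ℝ))), compl_Ioi,
    setLIntegral_congr (Iio_ae_eq_Iic (a := (0:ℝ))).symm, h2, h1, two_mul]

lemma pw_in {s Y : ℝ} (hs : -1 < s) (hY : 0 ≤ Y) :
    ∫⁻ u in Ioc 0 Y, ENNReal.ofReal (u ^ s) = ENNReal.ofReal (Y ^ (s + 1) / (s + 1)) := by
  have hi : IntegrableOn (fun u : ℝ => u ^ s) (Ioc 0 Y) := by
    rw [← intervalIntegrable_iff_integrableOn_Ioc_of_le hY]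
    exact intervalIntegral.intervalIntegrable_rpow' hs
  rw [← ofReal_integral_eq_lintegral_ofReal hi, ← intervalIntegral.integral_of_le hY,
    integral_rpow (Or.inl hs)]
  · rw [zero_rpow (by linarith)]
    simp
  · filter_upwards [ae_restrict_mem measurableSet_Ioc] with u hu
    exact rpow_nonneg hu.1.le _

lemma pw_out {s Y : ℝ} (hs : s < -1) (hY : 0 < Y) :
    ∫⁻ u in Ioi Y, ENNReal.ofReal (u ^ s) = ENNReal.ofReal (Y ^ (s + 1) / (-s - 1)) := by
  rw [← ofReal_integral_eq_lintegral_ofReal (integrableOn_Ioi_rpow_of_lt hs hY),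
    integral_Ioi_rpow_of_lt hs hY]
  · congr 1
    rw [neg_div, ← div_neg]
    congr 1
    ring
  · filter_upwards [ae_restrict_mem measurableSet_Ioi] with u hu
    exact rpow_nonneg (hY.trans hu).le _

lemma pw_in2 {s Y : ℝ} (hs : -1 < s) (hY : 0 ≤ Y) :
    ∫⁻ u, (if |u| ≤ Y then ENNReal.ofReal (|u| ^ s) else 0) =
      2 * ENNReal.ofReal (Y ^ (s + 1) / (s + 1)) := by
  rw [even_lint (fun u => if u ≤ Y then ENNReal.ofReal (u ^ s) else 0), ← pw_in hs hY]
  congr 1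
  rw [← lintegral_indicator measurableSet_Ioi, ← lintegral_indicator measurableSet_Ioc]
  congr 1
  ext u
  by_cases h1 : 0 < u <;> by_cases h2 : u ≤ Y <;> simp [indicator, h1, h2]

lemma pw_out2 {s Y : ℝ} (hs : s < -1) (hY : 0 < Y) :
    ∫⁻ u, (if Y < |u| then ENNReal.ofReal (|u| ^ s) else 0) =
      2 * ENNReal.ofReal (Y ^ (s + 1) / (-s - 1)) := by
  rw [even_lint (fun u => if Y < u then ENNReal.ofReal (u ^ s) else 0), ← pw_out hs hY]
  congr 1
  rw [← lintegral_indicator measurableSet_Ioi, ← lintegral_indicator measurableSet_Ioi]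
  congr 1
  ext u
  by_cases h1 : 0 < u <;> by_cases h2 : Y < u <;> simp [indicator, h1, h2]
  exact absurd (hY.trans h2) h1

lemma weak_strong {Z : Type*} [MeasurableSpace Z] (μ : Measure Z) (f : Z → ℝ)
    (hf : Measurable f) (hf0 : ∀ z, 0 ≤ f z) (ε K p0 p1 : ℝ) (hε : 0 ≤ ε) (hfε : ∀ z, f z ≤ ε)
    (hK : 0 ≤ K) (hp0 : 0 < p0) (hp : p0 < p1)
    (hw : ∀ s : ℝ, 0 < s → μ {z | s < f z} ≤ ENNReal.ofReal (K * s ^ (-p0))) :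
    ∫⁻ z, ENNReal.ofReal (f z ^ p1) ∂μ ≤
      ENNReal.ofReal (p1 / (p1 - p0) * K * ε ^ (p1 - p0)) := by
  rw [lintegral_rpow_eq_lintegral_meas_lt_mul μ (Eventually.of_forall hf0) hf.aemeasurable
    (hp0.trans hp)]
  have h1 : ∫⁻ t in Ioi (0:ℝ), μ {a | t < f a} * ENNReal.ofReal (t ^ (p1 - 1)) ≤
      ∫⁻ t in Ioc 0 ε, ENNReal.ofReal K * ENNReal.ofReal (t ^ (p1 - p0 - 1)) := by
    rw [← lintegral_indicator measurableSet_Ioi, ← lintegral_indicator measurableSet_Ioc]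
    refine lintegral_mono (fun t => ?_)
    by_cases h1 : 0 < t
    · by_cases h2 : t ≤ ε
      · simp only [indicator, mem_Ioi, h1, mem_Ioc, h2, and_self, if_true]
        refine (mul_le_mul_left (hw t h1) _).trans (le_of_eq ?_)
        rw [ENNReal.ofReal_mul hK, mul_assoc, ← ENNReal.ofReal_mul (by positivity),
          ← rpow_add h1]
        congr 3
        ring
      · have : {a | t < f a} = ∅ := by
          ext a
          simp only [mem_setOf_eq, mem_empty_iff_false, iff_false, not_lt]
          exact (hfε a).trans (not_le.1 h2).le
        simp [indicator, this]
    · simp [indicator, h1]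
  refine (mul_le_mul_right h1 _).trans (le_of_eq ?_)
  rw [lintegral_const_mul' _ _ ENNReal.ofReal_ne_top, pw_in (by linarith) hε,
    ← ENNReal.ofReal_mul hK, ← ENNReal.ofReal_mul (by linarith)]
  congr 1
  have : p1 - p0 ≠ 0 := by linarith
  rw [show p1 - p0 - 1 + 1 = p1 - p0 by ring]
  field_simp

lemma sing {G : ℝ → ℂ} (hG1 : ∀ θ, ‖G θ‖ ≤ 1) {ε κ : ℝ} (hε : 0 < ε) (hκ : 0 < κ) (hκ1 : κ < 1)
    (hG : ∫⁻ θ in arc, ‖G θ‖ₑ ≤ ENNReal.ofReal ε) (hGm : Measurable G) (c : ℝ) :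
    ∫⁻ θ in arc, ‖G θ‖ₑ * ENNReal.ofReal (|θ - c| ^ (κ - 1)) ≤
      ENNReal.ofReal ((2 / κ + 1) * ε ^ κ) := by
  have h1 : ∀ θ, ‖G θ‖ₑ * ENNReal.ofReal (|θ - c| ^ (κ - 1)) ≤
      (if |θ - c| ≤ ε then ENNReal.ofReal (|θ - c| ^ (κ - 1)) else 0) +
        ENNReal.ofReal (ε ^ (κ - 1)) * ‖G θ‖ₑ := by
    intro θ
    split_ifs with h
    · refine le_trans ?_ le_self_add
      have : ‖G θ‖ₑ ≤ 1 := by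
        rw [← ofReal_norm]; exact ENNReal.ofReal_le_one.2 (hG1 θ)
      exact (mul_le_mul_left this _).trans (one_mul _).le
    · rw [zero_add, mul_comm]
      refine mul_le_mul_left (ENNReal.ofReal_le_ofReal ?_) _
      exact rpow_le_rpow_of_nonpos hε (not_le.1 h).le (by linarith)
  refine (lintegral_mono h1).trans ?_
  rw [lintegral_add_right _ (hGm.enorm.const_mul _), lintegral_const_mul _ hGm.enorm]
  have h2 : ∫⁻ θ in arc, (if |θ - c| ≤ ε then ENNReal.ofReal (|θ - c| ^ (κ - 1)) else 0) ≤
      2 * ENNReal.ofReal (ε ^ (κ - 1 + 1) / (κ - 1 + 1)) := by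
    refine (setLIntegral_le_lintegral _ _).trans ?_
    rw [lintegral_sub_right_eq_self (fun θ => if |θ| ≤ ε then ENNReal.ofReal (|θ| ^ (κ - 1)) else 0),
      pw_in2 (by linarith) hε.le]
  refine (add_le_add h2 (mul_le_mul_right hG _)).trans (le_of_eq ?_)
  rw [← ENNReal.ofReal_mul (by positivity), sub_add_cancel,
    show (2 : ℝ≥0∞) = ENNReal.ofReal 2 by simp, ← ENNReal.ofReal_mul (by norm_num),
    ← ENNReal.ofReal_add (by positivity) (by positivity)]
  congr 1
  nth_rewrite 3 [← rpow_one ε]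
  rw [← rpow_add hε]
  rw [sub_add_cancel]
  ring

/-- The core operator on the arc. -/
def TT (G : ℝ → ℂ) (x y : ℝ) : ℂ := ∫ θ in arc, G θ * ep (x * sin θ + y * cos θ)

lemma arc_vol : volume arc ≠ ⊤ := by simp [arc]

lemma TT_meas {G : ℝ → ℂ} (hG : Measurable G) :
    Measurable (fun p : ℝ × ℝ => TT G p.1 p.2) := by
  have : StronglyMeasurable (Function.uncurry (fun (p : ℝ × ℝ) θ =>
      G θ * ep (p.1 * sin θ + p.2 * cos θ))) :=
    ((hG.comp measurable_snd).mul (ep_meas (by fun_prop))).stronglyMeasurable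
  exact this.integral_prod_right.measurable

lemma gep_enorm (g : ℂ) (t : ℝ) : ‖g * ep t‖ₑ = ‖g‖ₑ := by
  rw [enorm_mul, ← ofReal_norm (ep t), ep_norm]; simp

lemma norm_le_of_enorm {z : ℂ} {ε : ℝ} (hε : 0 ≤ ε) (h : ‖z‖ₑ ≤ ENNReal.ofReal ε) : ‖z‖ ≤ ε := by
  rw [← ofReal_norm] at h
  exact (ENNReal.ofReal_le_ofReal_iff hε).1 h

lemma TT_bound {G : ℝ → ℂ} {ε : ℝ} (hε : 0 ≤ ε)
    (hG : ∫⁻ θ in arc, ‖G θ‖ₑ ≤ ENNReal.ofReal ε) (x y : ℝ) : ‖TT G x y‖ ≤ ε := by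
  refine norm_le_of_enorm hε ?_
  refine (enorm_integral_le_lintegral_enorm _).trans ?_
  simp_rw [gep_enorm]
  exact hG

lemma cheb2 {Z : Type*} [MeasurableSpace Z] (μ : Measure Z) (h : Z → ℂ) (hm : Measurable h)
    {B τ : ℝ} (hτ : 0 < τ) (hB : ∫⁻ z, ‖h z‖ₑ ^ 2 ∂μ ≤ ENNReal.ofReal B) :
    μ {z | τ ≤ ‖h z‖} ≤ ENNReal.ofReal (B / τ ^ 2) := by
  have h1 : {z | τ ≤ ‖h z‖} = {z | ENNReal.ofReal (τ ^ 2) ≤ ‖h z‖ₑ ^ 2} := by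
    ext z
    simp only [mem_ofPred_eq]
    rw [← ofReal_norm, ← ENNReal.ofReal_pow (norm_nonneg _),
      ENNReal.ofReal_le_ofReal_iff (by positivity), sq_le_sq₀ hτ.le (norm_nonneg _)]
  rw [h1, ENNReal.ofReal_div_of_pos (by positivity)]
  refine (meas_ge_le_lintegral_div (hm.enorm.pow_const 2).aemeasurable (by simp [hτ.ne'])
    (by simp)).trans ?_
  gcongr

lemma enorm_le_one' {z : ℂ} (h : ‖z‖ ≤ 1) : ‖z‖ₑ ≤ 1 := by
  rw [← ofReal_norm]; exact ENNReal.ofReal_le_one.2 h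

lemma est_c {G : ℝ → ℂ} (hGm : Measurable G) (hG1 : ∀ θ, ‖G θ‖ ≤ 1) {ε : ℝ} (hε : 0 < ε)
    (hG : ∫⁻ θ in arc, ‖G θ‖ₑ ≤ ENNReal.ofReal ε) {p : ℝ} (hp : 2 ≤ p) (y : ℝ) :
    ∫⁻ x, ENNReal.ofReal (‖TT G x y‖ ^ p) ≤ ENNReal.ofReal (4 * π * ε ^ (p - 1)) := by
  have := IsFiniteMeasure.mk (μ := volume.restrict arc) (by simpa using arc_vol.lt_top)
  have h1 := plan1 (volume.restrict arc) sin measurable_sin (fun θ => G θ * ep (y * cos θ))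
    (hGm.mul (ep_meas (by fun_prop))) 1 (by intro θ; rw [norm_mul, ep_norm, mul_one]; exact hG1 θ)
    (fun _ => 1 / 2) measurable_const (by simp) _ (fun δ hδ c => ker_c hδ c)
  have h2 : ∀ x, (∫ z in arc, G z * ep (y * cos z) * ep (x * sin z)) = TT G x y := by
    intro x
    unfold TT
    congr 1
    ext z
    rw [add_comm, ep_add]
    ring
  simp_rw [h2, gep_enorm] at h1
  have h3 : ∫⁻ z in arc, ‖G z‖ₑ ^ 2 / ENNReal.ofReal (1 / 2) ≤ ENNReal.ofReal (2 * ε) := by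
    calc _ ≤ ∫⁻ z in arc, 2 * ‖G z‖ₑ := by
          refine lintegral_mono (fun z => ?_)
          rw [ENNReal.div_eq_inv_mul, ← ENNReal.ofReal_inv_of_pos (by norm_num)]
          norm_num
          gcongr
          rw [sq]
          exact (mul_le_mul_left (enorm_le_one' (hG1 z)) _).trans (one_mul _).le
      _ ≤ _ := by
          rw [lintegral_const_mul _ hGm.enorm, ENNReal.ofReal_mul (by norm_num)]
          norm_num
          gcongr
  calc _ ≤ ∫⁻ x, ENNReal.ofReal (ε ^ (p - 2)) * ‖TT G x y‖ₑ ^ 2 := by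
        refine lintegral_mono (fun x => ?_)
        rw [← ofReal_norm, ← ENNReal.ofReal_pow (norm_nonneg _), ← ENNReal.ofReal_mul (by positivity)]
        refine ENNReal.ofReal_le_ofReal ?_
        have h4 := TT_bound hε.le hG x y
        rcases (norm_nonneg (TT G x y)).eq_or_lt with h0 | h0
        · rw [← h0, zero_rpow (by linarith)]; positivity
        calc ‖TT G x y‖ ^ p = ‖TT G x y‖ ^ (p - 2) * ‖TT G x y‖ ^ 2 := by
              rw [← rpow_natCast, ← rpow_add h0]; norm_num
          _ ≤ _ := by gcongr
    _ ≤ ENNReal.ofReal (ε ^ (p - 2)) * (ENNReal.ofReal (2 * π) * ENNReal.ofReal (2 * ε)) := by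
        rw [lintegral_const_mul' _ _ ENNReal.ofReal_ne_top]
        gcongr
        exact h1.trans (by gcongr)
    _ = _ := by
        rw [← ENNReal.ofReal_mul (by positivity), ← ENNReal.ofReal_mul (by positivity)]
        congr 1
        rw [show p - 1 = (p - 2) + 1 by ring, rpow_add hε, rpow_one]
        ring

lemma inv_sin_bd {κ Δ u : ℝ} (hκ : 0 < κ) (hΔ : 0 < Δ) (hu : Δ < |u|) (hu2 : |u| ≤ π / 2) :
    (ENNReal.ofReal |sin u|)⁻¹ ≤ ENNReal.ofReal (π / 2 * Δ ^ (-κ)) * ENNReal.ofReal (|u| ^ (κ - 1)) := by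
  have h0 : 0 < |u| := hΔ.trans hu
  have h1 := mul_abs_le_abs_sin hu2
  have h2 : 0 < 2 / π * |u| := by have := pi_pos; positivity
  rw [← ENNReal.ofReal_inv_of_pos (h2.trans_le h1), ← ENNReal.ofReal_mul (by positivity)]
  refine ENNReal.ofReal_le_ofReal ?_
  calc |sin u|⁻¹ ≤ (2 / π * |u|)⁻¹ := inv_anti₀ h2 h1
    _ = π / 2 * |u| ^ (-κ) * |u| ^ (κ - 1) := by
      rw [mul_assoc, ← rpow_add h0, show -κ + (κ - 1) = -1 by ring, rpow_neg_one, mul_inv, inv_div]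
    _ ≤ _ := by
      gcongr ?_ * ?_ * _
      exact rpow_le_rpow_of_nonpos hΔ hu.le (by linarith)

lemma div_bd {g : ℂ} (hg : ‖g‖ ≤ 1) {A B : ℝ≥0∞} (h : A⁻¹ ≤ B) : ‖g‖ₑ ^ 2 / A ≤ ‖g‖ₑ * B := by
  rw [ENNReal.div_eq_inv_mul, mul_comm]
  gcongr
  rw [sq]
  exact (mul_le_mul_left (enorm_le_one' hg) _).trans (one_mul _).le

lemma est_d_weak {G : ℝ → ℂ} (hGm : Measurable G) (hG1 : ∀ θ, ‖G θ‖ ≤ 1) {ε κ : ℝ} (hε : 0 < ε)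
    (hκ : 0 < κ) (hκ1 : κ < 1)
    (hG : ∫⁻ θ in arc, ‖G θ‖ₑ ≤ ENNReal.ofReal ε) (x s : ℝ) (hs : 0 < s) :
    volume {y | s < ‖TT G x y‖} ≤
      ENNReal.ofReal ((8 * π ^ 2 * 4 ^ κ * (2 / κ + 1)) * ε ^ κ * s ^ (-(2 + κ))) := by
  have hfa := IsFiniteMeasure.mk (μ := volume.restrict arc) (by simpa using arc_vol.lt_top)
  set Δ := s / 4 with hΔd
  have hΔ : 0 < Δ := by positivity
  set N : Set ℝ := {θ | |θ| ≤ Δ} with hN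
  have hNm : MeasurableSet N := measurableSet_le measurable_id.abs measurable_const
  set far : ℝ → ℂ := fun y => ∫ θ in arc ∩ Nᶜ, G θ * ep (x * sin θ) * ep (y * cos θ) with hfar
  have hbd : ∀ θ, ‖G θ * ep (x * sin θ)‖ ≤ 1 := by
    intro θ; rw [norm_mul, ep_norm, mul_one]; exact hG1 θ
  have hgm : Measurable (fun θ => G θ * ep (x * sin θ)) := hGm.mul (ep_meas (by fun_prop))
  have hint : ∀ y, Integrable (fun θ => G θ * ep (x * sin θ) * ep (y * cos θ))
      (volume.restrict arc) := by
    intro y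
    refine Integrable.of_bound (hgm.mul (ep_meas (by fun_prop))).aestronglyMeasurable 1 ?_
    filter_upwards with θ
    rw [norm_mul, ep_norm, mul_one]; exact hbd θ
  have hsplit : ∀ y, TT G x y = (∫ θ in arc ∩ N, G θ * ep (x * sin θ) * ep (y * cos θ)) + far y := by
    intro y
    have h := integral_add_compl hNm (hint y)
    rw [Measure.restrict_restrict hNm, Measure.restrict_restrict hNm.compl, inter_comm,
      inter_comm Nᶜ] at h
    rw [hfar]
    simp only
    rw [h]
    unfold TT
    congr 1
    ext θ
    rw [ep_add, mul_assoc]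
  have hnear : ∀ y, ‖∫ θ in arc ∩ N, G θ * ep (x * sin θ) * ep (y * cos θ)‖ ≤ s / 2 := by
    intro y
    refine norm_le_of_enorm (by positivity) ((enorm_integral_le_lintegral_enorm _).trans ?_)
    simp_rw [gep_enorm]
    calc _ ≤ ∫⁻ θ in arc ∩ N, 1 := lintegral_mono (fun θ => enorm_le_one' (hG1 θ))
      _ = volume (arc ∩ N) := by simp
      _ ≤ volume (Icc (-Δ) Δ) := measure_mono (fun θ hθ => abs_le.1 hθ.2)
      _ = _ := by rw [Real.volume_Icc]; congr 1; rw [hΔd]; ring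
  have hfarm : Measurable far := by
    have : StronglyMeasurable (Function.uncurry (fun (y : ℝ) θ =>
        G θ * ep (x * sin θ) * ep (y * cos θ))) :=
      ((hgm.comp measurable_snd).mul (ep_meas (by fun_prop))).stronglyMeasurable
    exact this.integral_prod_right.measurable
  have hfin2 : IsFiniteMeasure (volume.restrict (arc ∩ Nᶜ)) :=
    ⟨by simpa using lt_of_le_of_lt (measure_mono inter_subset_left) arc_vol.lt_top⟩
  have hms : MeasurableSet (arc ∩ Nᶜ) := arc_meas.inter hNm.compl
  have hpt : ∀ θ ∈ arc ∩ Nᶜ, Δ < |θ| ∧ |θ| ≤ π / 2 := fun θ hθ =>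
    ⟨not_le.1 hθ.2, abs_le.2 (arc_mem_half hθ.1)⟩
  have hL2 : ∫⁻ y, ‖far y‖ₑ ^ 2 ≤
      ENNReal.ofReal (4 * π * (π / 2 * Δ ^ (-κ) * ((2 / κ + 1) * ε ^ κ))) := by
    refine (plan1 (volume.restrict (arc ∩ Nᶜ)) cos measurable_cos _ hgm 1 hbd
      (fun θ => |sin θ|) measurable_sin.abs ?_ (2 * ENNReal.ofReal (2 * π)) ?_).trans ?_
    · filter_upwards [ae_restrict_mem hms] with θ hθ
      have := mul_abs_le_abs_sin (hpt θ hθ).2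
      have h0 : 0 < |θ| := hΔ.trans (hpt θ hθ).1
      have := pi_pos
      have : 0 < 2 / π * |θ| := by positivity
      linarith
    · intro δ hδ c
      exact (lintegral_mono_set inter_subset_left).trans (ker_d hδ c)
    · have h5 : ∫⁻ θ in arc ∩ Nᶜ, ‖G θ * ep (x * sin θ)‖ₑ ^ 2 / ENNReal.ofReal |sin θ| ≤
          ENNReal.ofReal (π / 2 * Δ ^ (-κ)) * ENNReal.ofReal ((2 / κ + 1) * ε ^ κ) := by
        refine le_trans ?_ (mul_le_mul_right (sing hG1 hε hκ hκ1 hG hGm 0) _)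
        rw [← lintegral_const_mul' _ _ ENNReal.ofReal_ne_top]
        refine le_trans ?_ (lintegral_mono_set (s := arc ∩ Nᶜ) inter_subset_left)
        refine setLIntegral_mono' hms (fun θ hθ => ?_)
        rw [gep_enorm]
        refine (div_bd (hG1 θ) (inv_sin_bd hκ hΔ (hpt θ hθ).1 (hpt θ hθ).2)).trans (le_of_eq ?_)
        rw [sub_zero]
        ring
      refine (mul_le_mul_right h5 _).trans (le_of_eq ?_)
      rw [show (2 : ℝ≥0∞) = ENNReal.ofReal 2 by simp, ← ENNReal.ofReal_mul (by positivity),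
        ← ENNReal.ofReal_mul (by positivity), ← ENNReal.ofReal_mul (by positivity)]
      congr 1
      ring
  have hsub : {y | s < ‖TT G x y‖} ⊆ {y | s / 2 ≤ ‖far y‖} := by
    intro y hy
    have h6 : s < ‖TT G x y‖ := hy
    rw [hsplit y] at h6
    have := norm_add_le (∫ θ in arc ∩ N, G θ * ep (x * sin θ) * ep (y * cos θ)) (far y)
    have := hnear y
    show s / 2 ≤ ‖far y‖
    linarith
  refine (measure_mono hsub).trans ((cheb2 volume far hfarm (by positivity) hL2).trans
    (le_of_eq ?_))
  congr 1
  rw [hΔd, div_rpow hs.le (by norm_num), rpow_neg (by norm_num : (0:ℝ) ≤ 4), neg_add, rpow_add hs,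
    rpow_neg hs.le 2, rpow_two]
  have : (4:ℝ) ^ κ ≠ 0 := by positivity
  field_simp
  ring

lemma est_d {G : ℝ → ℂ} (hGm : Measurable G) (hG1 : ∀ θ, ‖G θ‖ ≤ 1) {ε κ : ℝ} (hε : 0 < ε)
    (hκ : 0 < κ) (hκ1 : κ < 1)
    (hG : ∫⁻ θ in arc, ‖G θ‖ₑ ≤ ENNReal.ofReal ε) (x : ℝ) :
    ∫⁻ y, ENNReal.ofReal (‖TT G x y‖ ^ (2 + 2 * κ)) ≤
      ENNReal.ofReal (((2 + 2 * κ) / κ * (8 * π ^ 2 * 4 ^ κ * (2 / κ + 1))) * ε ^ (2 * κ)) := by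
  refine (weak_strong volume (fun y => ‖TT G x y‖)
    ((TT_meas hGm).comp (measurable_const.prodMk measurable_id)).norm (fun _ => norm_nonneg _)
    ε _ (2 + κ) (2 + 2 * κ) hε.le (fun y => TT_bound hε.le hG x y) (by positivity) (by positivity)
    (by linarith) (fun s hs => est_d_weak hGm hG1 hε hκ hκ1 hG x s hs)).trans (le_of_eq ?_)
  congr 1
  rw [show 2 + 2 * κ - (2 + κ) = κ by ring, show 2 * κ = κ + κ by ring, rpow_add hε]
  ring

lemma est_b_weak {G : ℝ → ℂ} (hGm : Measurable G) (hG1 : ∀ θ, ‖G θ‖ ≤ 1) {ε κ : ℝ} (hε : 0 < ε)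
    (hκ : 0 < κ) (hκ1 : κ < 1)
    (hG : ∫⁻ θ in arc, ‖G θ‖ₑ ≤ ENNReal.ofReal ε) (s : ℝ) (hs : 0 < s) :
    volume {p : ℝ × ℝ | s < ‖TT G p.1 p.2‖} ≤
      ENNReal.ofReal ((16 * π ^ 3 * 4 ^ κ * (2 / κ + 1)) * ε ^ (1 + 2 * κ) * s ^ (-(4 + 2 * κ))) := by
  have hfa := IsFiniteMeasure.mk (μ := volume.restrict arc) (by simpa using arc_vol.lt_top)
  set Δ := s ^ 2 / (4 * ε) with hΔd
  have hΔ : 0 < Δ := by positivity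
  set N : Set (ℝ × ℝ) := {z | |z.1 - z.2| ≤ Δ} with hN
  have hNm : MeasurableSet N :=
    measurableSet_le (measurable_fst.sub measurable_snd).abs measurable_const
  set A : Set (ℝ × ℝ) := arc ×ˢ arc with hA
  have hAm : MeasurableSet A := arc_meas.prod arc_meas
  have hArest : (volume : Measure (ℝ × ℝ)).restrict A =
      (volume.restrict arc).prod (volume.restrict arc) := by
    rw [Measure.volume_eq_prod, Measure.prod_restrict]
  have hAfin : IsFiniteMeasure ((volume : Measure (ℝ × ℝ)).restrict A) := by
    rw [hArest]; infer_instance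
  set g : ℝ × ℝ → ℂ := fun z => G z.1 * G z.2 with hgd
  have hgm : Measurable g := (hGm.comp measurable_fst).mul (hGm.comp measurable_snd)
  have hbd : ∀ z, ‖g z‖ ≤ 1 := by
    intro z
    rw [hgd]
    simp only [norm_mul]
    exact mul_le_one₀ (hG1 _) (norm_nonneg _) (hG1 _)
  set ph : ℝ × ℝ → ℝ × ℝ → ℝ := fun p z =>
    p.1 * (sin z.1 + sin z.2) + p.2 * (cos z.1 + cos z.2) with hph
  set far : ℝ × ℝ → ℂ := fun p => ∫ z in A ∩ Nᶜ, g z * ep (ph p z) with hfar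
  have hint : ∀ p, Integrable (fun z => g z * ep (ph p z)) (volume.restrict A) := by
    intro p
    refine Integrable.of_bound (hgm.mul (ep_meas (by fun_prop))).aestronglyMeasurable 1 ?_
    filter_upwards with z
    rw [norm_mul, ep_norm, mul_one]; exact hbd z
  have hsplit : ∀ p : ℝ × ℝ, TT G p.1 p.2 * TT G p.1 p.2 =
      (∫ z in A ∩ N, g z * ep (ph p z)) + far p := by
    intro p
    have h := integral_add_compl hNm (hint p)
    rw [Measure.restrict_restrict hNm, Measure.restrict_restrict hNm.compl, inter_comm,
      inter_comm Nᶜ] at h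
    rw [hfar]
    simp only
    rw [h, hArest]
    unfold TT
    rw [← integral_prod_mul]
    congr 1
    ext z
    simp only [hgd, hph]
    rw [show p.1 * (sin z.1 + sin z.2) + p.2 * (cos z.1 + cos z.2) =
      (p.1 * sin z.1 + p.2 * cos z.1) + (p.1 * sin z.2 + p.2 * cos z.2) by ring,
      ep_add (p.1 * sin z.1 + p.2 * cos z.1)]
    ring
  have hmulint : ∀ (k : ℝ → ℝ → ℝ≥0∞) (B : ℝ), Measurable (Function.uncurry k) → 
      (∀ c, ∫⁻ θ in arc, ‖G θ‖ₑ * k θ c ≤ ENNReal.ofReal B) →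
      ∫⁻ z in A, ‖g z‖ₑ * k z.1 z.2 ≤ ENNReal.ofReal B * ENNReal.ofReal ε := by
    intro k B hk hB
    have hkm : Measurable (fun z : ℝ × ℝ => k z.1 z.2) := hk
    rw [hArest, lintegral_prod_symm (fun z : ℝ × ℝ => ‖g z‖ₑ * k z.1 z.2)
      (hgm.enorm.mul hkm).aemeasurable]
    calc _ ≤ ∫⁻ c in arc, ENNReal.ofReal B * ‖G c‖ₑ := by
          refine lintegral_mono (fun c => ?_)
          simp only [hgd, enorm_mul]
          have : ∀ θ, ‖G θ‖ₑ * ‖G c‖ₑ * k θ c = ‖G c‖ₑ * (‖G θ‖ₑ * k θ c) := fun θ => by ring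
          simp_rw [this]
          rw [lintegral_const_mul' _ _ (by simp), mul_comm]
          gcongr
          exact hB c
      _ ≤ _ := by
          rw [lintegral_const_mul' _ _ ENNReal.ofReal_ne_top]
          gcongr
  have hnear : ∀ p, ‖∫ z in A ∩ N, g z * ep (ph p z)‖ ≤ s ^ 2 / 2 := by
    intro p
    refine norm_le_of_enorm (by positivity) ((enorm_integral_le_lintegral_enorm _).trans ?_)
    simp_rw [gep_enorm]
    have hk : Measurable (Function.uncurry
        (fun a b : ℝ => (if |a - b| ≤ Δ then (1 : ℝ≥0∞) else 0))) :=
      Measurable.ite hNm measurable_const measurable_const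
    have h7 := hmulint _ (2 * Δ) hk ?_
    · calc _ = ∫⁻ z in A, ‖g z‖ₑ * (if |z.1 - z.2| ≤ Δ then (1 : ℝ≥0∞) else 0) := by
            rw [inter_comm, ← Measure.restrict_restrict hNm, ← lintegral_indicator hNm]
            congr 1
            ext z
            by_cases hz : z ∈ N
            · have hz' : |z.1 - z.2| ≤ Δ := hz
              simp [hz, hz']
            · have hz' : ¬ |z.1 - z.2| ≤ Δ := hz
              simp [hz, hz']
        _ ≤ _ := h7
        _ = _ := by
          rw [← ENNReal.ofReal_mul (by positivity)]
          congr 1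
          rw [hΔd]
          field_simp
          ring
    · intro c
      calc _ ≤ ∫⁻ θ in arc, (Icc (c - Δ) (c + Δ)).indicator 1 θ := by
            refine lintegral_mono (fun θ => ?_)
            simp only
            split_ifs with h
            · have h' := abs_le.1 h
              have h8 : θ ∈ Icc (c - Δ) (c + Δ) := ⟨by linarith, by linarith⟩
              rw [indicator_of_mem h8, mul_one]
              exact enorm_le_one' (hG1 θ)
            · simp
        _ ≤ ∫⁻ θ, (Icc (c - Δ) (c + Δ)).indicator 1 θ := setLIntegral_le_lintegral _ _
        _ = _ := by
          rw [lintegral_indicator_one measurableSet_Icc, Real.volume_Icc]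
          congr 1
          ring
  have hfarm : Measurable far := by
    have : StronglyMeasurable (Function.uncurry (fun (p : ℝ × ℝ) z => g z * ep (ph p z))) :=
      ((hgm.comp measurable_snd).mul (ep_meas (by fun_prop))).stronglyMeasurable
    exact this.integral_prod_right.measurable
  have hfin2 : IsFiniteMeasure ((volume : Measure (ℝ × ℝ)).restrict (A ∩ Nᶜ)) :=
    ⟨by
      have := hAfin.measure_univ_lt_top
      simp only [Measure.restrict_apply_univ] at this ⊢
      exact lt_of_le_of_lt (measure_mono inter_subset_left) this⟩
  have hms : MeasurableSet (A ∩ Nᶜ) := hAm.inter hNm.compl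
  have hpt : ∀ z ∈ A ∩ Nᶜ, Δ < |z.1 - z.2| ∧ |z.1 - z.2| ≤ π / 2 := by
    intro z hz
    refine ⟨not_le.1 hz.2, abs_le.2 ?_⟩
    obtain ⟨⟨h1, h2⟩, h3, h4⟩ := hz.1
    constructor <;> linarith
  have hL2 : ∫⁻ p, ‖far p‖ₑ ^ 2 ≤
      ENNReal.ofReal (8 * π ^ 2 * (π / 2 * Δ ^ (-κ) * ((2 / κ + 1) * ε ^ κ * ε))) := by
    refine (plan2 (volume.restrict (A ∩ Nᶜ)) (fun z => sin z.1 + sin z.2)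
      (fun z => cos z.1 + cos z.2) (by fun_prop) (by fun_prop) _ hgm 1 hbd
      (fun z => |sin (z.1 - z.2)|) (measurable_sin.comp (measurable_fst.sub measurable_snd)).abs ?_
      (2 * (ENNReal.ofReal (2 * π) * ENNReal.ofReal (2 * π))) ?_).trans ?_
    · filter_upwards [ae_restrict_mem hms] with θ hθ
      have := mul_abs_le_abs_sin (hpt θ hθ).2
      have h0 : 0 < |θ.1 - θ.2| := hΔ.trans (hpt θ hθ).1
      have := pi_pos
      have : 0 < 2 / π * |θ.1 - θ.2| := by positivity
      linarith
    · intro δ hδ c d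
      exact (lintegral_mono_set inter_subset_left).trans (ker_b hδ c d)
    · have h5 : ∫⁻ z in A ∩ Nᶜ, ‖g z‖ₑ ^ 2 / ENNReal.ofReal |sin (z.1 - z.2)| ≤
          ENNReal.ofReal (π / 2 * Δ ^ (-κ)) *
            (ENNReal.ofReal ((2 / κ + 1) * ε ^ κ) * ENNReal.ofReal ε) := by
        have hk : Measurable (Function.uncurry
            (fun a b : ℝ => ENNReal.ofReal (|a - b| ^ (κ - 1)))) :=
          (((measurable_fst.sub measurable_snd).abs).pow_const _).ennreal_ofReal
        refine le_trans ?_ (mul_le_mul_right (hmulint _ _ hk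
          (fun c => sing hG1 hε hκ hκ1 hG hGm c)) _)
        rw [← lintegral_const_mul' _ _ ENNReal.ofReal_ne_top]
        refine le_trans ?_ (lintegral_mono_set (s := A ∩ Nᶜ) inter_subset_left)
        refine setLIntegral_mono' hms (fun z hz => ?_)
        refine (div_bd (hbd z) (inv_sin_bd hκ hΔ (hpt z hz).1 (hpt z hz).2)).trans (le_of_eq ?_)
        ring
      refine (mul_le_mul_right h5 _).trans (le_of_eq ?_)
      rw [show (2 : ℝ≥0∞) = ENNReal.ofReal 2 by simp, ← ENNReal.ofReal_mul (by positivity),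
        ← ENNReal.ofReal_mul (by positivity), ← ENNReal.ofReal_mul (by positivity),
        ← ENNReal.ofReal_mul (by positivity), ← ENNReal.ofReal_mul (by positivity)]
      congr 1
      ring
  have hsub : {p : ℝ × ℝ | s < ‖TT G p.1 p.2‖} ⊆ {p | s ^ 2 / 2 ≤ ‖far p‖} := by
    intro p hp
    have h6 : s < ‖TT G p.1 p.2‖ := hp
    have h7 : s ^ 2 < ‖TT G p.1 p.2 * TT G p.1 p.2‖ := by
      rw [norm_mul, ← sq]
      gcongr
    rw [hsplit p] at h7
    have := norm_add_le (∫ z in A ∩ N, g z * ep (ph p z)) (far p)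
    have := hnear p
    show s ^ 2 / 2 ≤ ‖far p‖
    linarith
  refine (measure_mono hsub).trans ((cheb2 volume far hfarm (by positivity) hL2).trans
    (le_of_eq ?_))
  congr 1
  have e1 : Δ ^ (-κ) = s ^ (-(2 * κ)) * 4 ^ κ * ε ^ κ := by
    rw [hΔd, div_rpow (by positivity) (by positivity), mul_rpow (by norm_num) hε.le,
      rpow_neg (by norm_num : (0:ℝ) ≤ 4), rpow_neg hε.le, ← rpow_natCast, ← rpow_mul hs.le,
      ← mul_inv, div_inv_eq_mul]
    push_cast
    rw [mul_neg]
    ring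
  have e2 : s ^ (-(4 + 2 * κ)) = s ^ (-(2 * κ)) * (s ^ 4)⁻¹ := by
    rw [← rpow_natCast, ← rpow_neg hs.le, ← rpow_add hs]
    congr 1
    push_cast
    ring
  have e3 : ε ^ (1 + 2 * κ) = ε * (ε ^ κ * ε ^ κ) := by
    rw [rpow_add hε, rpow_one, two_mul, rpow_add hε]
  rw [e1, e2, e3]
  field_simp
  ring

lemma est_b {G : ℝ → ℂ} (hGm : Measurable G) (hG1 : ∀ θ, ‖G θ‖ ≤ 1) {ε κ : ℝ} (hε : 0 < ε)
    (hκ : 0 < κ) (hκ1 : κ < 1)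
    (hG : ∫⁻ θ in arc, ‖G θ‖ₑ ≤ ENNReal.ofReal ε) :
    ∫⁻ p : ℝ × ℝ, ENNReal.ofReal (‖TT G p.1 p.2‖ ^ (2 * (2 + 2 * κ))) ≤
      ENNReal.ofReal (((4 + 4 * κ) / (2 * κ) * (16 * π ^ 3 * 4 ^ κ * (2 / κ + 1))) *
        ε ^ (1 + 4 * κ)) := by
  have h := weak_strong volume (fun p : ℝ × ℝ => ‖TT G p.1 p.2‖)
    (TT_meas hGm).norm (fun _ => norm_nonneg _)
    ε _ (4 + 2 * κ) (2 * (2 + 2 * κ)) hε.le (fun p => TT_bound hε.le hG p.1 p.2) (by positivity)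
    (by positivity)
    (by linarith) (fun s hs => est_b_weak hGm hG1 hε hκ hκ1 hG s hs)
  refine h.trans (le_of_eq ?_)
  congr 1
  rw [show 2 * (2 + 2 * κ) - (4 + 2 * κ) = 2 * κ by ring,
    show 1 + 4 * κ = (1 + 2 * κ) + 2 * κ by ring, rpow_add hε (1 + 2 * κ)]
  ring

lemma interp (φ : ℝ × ℝ → ℝ≥0∞) (hφ : Measurable φ) {p U V : ℝ} (hp : 0 < p)
    (hU0 : 0 ≤ U) (hU1 : U ≤ 1) (hV0 : 0 ≤ V) (hV1 : V ≤ 1) (B C D Γ H : ℝ≥0∞)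
    (hB : ∫⁻ z, φ z ^ (2 * p) ≤ B) (hC : ∀ y, ∫⁻ x, φ (x, y) ^ p ≤ C)
    (hD : ∀ x, ∫⁻ y, φ (x, y) ^ p ≤ D) (g h : ℝ → ℝ≥0∞) (hg : Measurable g) (hh : Measurable h)
    (hΓ : ∫⁻ x, g x ≤ Γ) (hH : ∫⁻ y, h y ≤ H) :
    ∫⁻ z : ℝ × ℝ, φ z ^ (p * (2 - U - V)) * (g z.1 ^ U * h z.2 ^ V) ≤
      B ^ ((1 - U) * (1 - V)) * (C * H) ^ (V * (1 - U)) * (D * Γ) ^ (U * (1 - V)) *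
        (Γ * H) ^ (U * V) := by
  have hU' : 0 ≤ 1 - U := by linarith
  have hV' : 0 ≤ 1 - V := by linarith
  have hφp : Measurable (fun z => φ z ^ p) := hφ.pow_const p
  have hg1 : Measurable (fun z : ℝ × ℝ => g z.1) := hg.comp measurable_fst
  have hh1 : Measurable (fun z : ℝ × ℝ => h z.2) := hh.comp measurable_snd
  have key := ENNReal.lintegral_prod_norm_pow_le (μ := (volume : Measure (ℝ × ℝ))) Finset.univ
    (f := ![fun z => φ z ^ (2 * p), fun z => φ z ^ p * h z.2, fun z => φ z ^ p * g z.1,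
      fun z => g z.1 * h z.2])
    (p := ![(1 - U) * (1 - V), V * (1 - U), U * (1 - V), U * V])
    (by
      intro i _
      fin_cases i
      · exact (hφ.pow_const _).aemeasurable
      · exact (hφp.mul hh1).aemeasurable
      · exact (hφp.mul hg1).aemeasurable
      · exact (hg1.mul hh1).aemeasurable)
    (by simp [Fin.sum_univ_four]; ring)
    (by
      intro i _
      fin_cases i <;> simp <;> positivity)
  simp only [Fin.prod_univ_four] at key
  have e1 : ∀ z : ℝ × ℝ, φ z ^ (p * (2 - U - V)) * (g z.1 ^ U * h z.2 ^ V) =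
      (φ z ^ (2 * p)) ^ ((1 - U) * (1 - V)) * (φ z ^ p * h z.2) ^ (V * (1 - U)) *
        (φ z ^ p * g z.1) ^ (U * (1 - V)) * (g z.1 * h z.2) ^ (U * V) := by
    intro z
    have n1 : 0 ≤ (1 - U) * (1 - V) := by positivity
    have n2 : 0 ≤ V * (1 - U) := by positivity
    have n3 : 0 ≤ U * (1 - V) := by positivity
    have n4 : 0 ≤ U * V := by positivity
    rw [ENNReal.mul_rpow_of_nonneg _ _ n2, ENNReal.mul_rpow_of_nonneg _ _ n3,
      ENNReal.mul_rpow_of_nonneg _ _ n4, ← ENNReal.rpow_mul, ← ENNReal.rpow_mul, ← ENNReal.rpow_mul]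
    rw [show p * (2 - U - V) = 2 * p * ((1 - U) * (1 - V)) + p * (V * (1 - U)) + p * (U * (1 - V))
      by ring, ENNReal.rpow_add_of_nonneg _ _ (by positivity) (by positivity),
      ENNReal.rpow_add_of_nonneg _ _ (by positivity) (by positivity)]
    have eU : g z.1 ^ U = g z.1 ^ (U * (1 - V)) * g z.1 ^ (U * V) := by
      rw [← ENNReal.rpow_add_of_nonneg _ _ n3 n4]; congr 1; ring
    have eV : h z.2 ^ V = h z.2 ^ (V * (1 - U)) * h z.2 ^ (U * V) := by
      rw [← ENNReal.rpow_add_of_nonneg _ _ n2 n4]; congr 1; ring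
    rw [eU, eV]
    ring
  simp_rw [e1]
  refine (key.trans ?_)
  simp only [Matrix.cons_val]
  gcongr
  · rw [Measure.volume_eq_prod, lintegral_prod_symm (fun z : ℝ × ℝ => φ z ^ p * h z.2)
      (hφp.mul hh1).aemeasurable]
    calc _ ≤ ∫⁻ y, C * h y := by
          refine lintegral_mono (fun y => ?_)
          simp only
          rw [lintegral_mul_const (f := fun x => φ (x, y) ^ p) _
            (hφp.comp (measurable_id.prodMk measurable_const))]
          gcongr
          exact hC y
      _ ≤ _ := by
          rw [lintegral_const_mul _ hh]; gcongr
  · rw [Measure.volume_eq_prod, lintegral_prod (fun z : ℝ × ℝ => φ z ^ p * g z.1)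
      (hφp.mul hg1).aemeasurable]
    calc _ ≤ ∫⁻ x, D * g x := by
          refine lintegral_mono (fun x => ?_)
          simp only
          rw [lintegral_mul_const (f := fun y => φ (x, y) ^ p) _
            (hφp.comp (measurable_const.prodMk measurable_id))]
          gcongr
          exact hD x
      _ ≤ _ := by
          rw [lintegral_const_mul _ hg]; gcongr
  · rw [Measure.volume_eq_prod, lintegral_prod_mul hg.aemeasurable hh.aemeasurable]
    gcongr

lemma core_interp {κ : ℝ} (hκ : 0 < κ) (hκ1 : κ < 1) : ∃ K : ℝ, 1 ≤ K ∧
    ∀ (G : ℝ → ℂ) (ε q U V : ℝ) (g h : ℝ → ℝ≥0∞) (Γ H : ℝ), Measurable G → (∀ θ, ‖G θ‖ ≤ 1) →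
    0 < ε → (∫⁻ θ in arc, ‖G θ‖ₑ ≤ ENNReal.ofReal ε) → 0 < q → 0 ≤ U → U ≤ 1 → 0 ≤ V → V ≤ 1 →
    (2 + 2 * κ) * (2 - U - V) ≤ q → Measurable g → Measurable h → 0 < Γ → 0 < H →
    ∫⁻ x, g x ≤ ENNReal.ofReal Γ → ∫⁻ y, h y ≤ ENNReal.ofReal H →
    ∫⁻ z : ℝ × ℝ, ENNReal.ofReal (‖TT G z.1 z.2‖ ^ q) * (g z.1 ^ U * h z.2 ^ V) ≤
      ENNReal.ofReal (K * ε ^ (q - 3 + U + 2 * V) * Γ ^ U * H ^ V) := by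
  set K1 := 4 * π
  set K2 := (2 + 2 * κ) / κ * (8 * π ^ 2 * 4 ^ κ * (2 / κ + 1))
  set K3 := (4 + 4 * κ) / (2 * κ) * (16 * π ^ 3 * 4 ^ κ * (2 / κ + 1))
  have hK1 : 0 < K1 := by positivity
  have hK2 : 0 < K2 := by positivity
  have hK3 : 0 < K3 := by positivity
  set K := 1 + K1 + K2 + K3 with hK
  have hKpos : 0 < K := by positivity
  refine ⟨K, by linarith, ?_⟩
  intro G ε q U V g h Γ H hGm hG1 hε hG hq hU0 hU1 hV0 hV1 hpq hg hh hΓ0 hH0 hΓ hH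
  set φ : ℝ × ℝ → ℝ≥0∞ := fun z => ENNReal.ofReal ‖TT G z.1 z.2‖ with hφd
  have hφ : Measurable φ := (TT_meas hGm).norm.ennreal_ofReal
  have hpow : ∀ z, ∀ s : ℝ, 0 ≤ s → φ z ^ s = ENNReal.ofReal (‖TT G z.1 z.2‖ ^ s) := fun z s hs =>
    ENNReal.ofReal_rpow_of_nonneg (norm_nonneg _) hs
  have main := interp φ hφ (p := 2 + 2 * κ) (by linarith) hU0 hU1 hV0 hV1
    (ENNReal.ofReal (K * ε ^ (1 + 4 * κ))) (ENNReal.ofReal (K * ε ^ (1 + 2 * κ)))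
    (ENNReal.ofReal (K * ε ^ (2 * κ))) (ENNReal.ofReal Γ) (ENNReal.ofReal H)
    (by
      simp_rw [fun z => hpow z (2 * (2 + 2 * κ)) (by positivity)]
      refine (est_b hGm hG1 hε hκ hκ1 hG).trans (ENNReal.ofReal_le_ofReal ?_)
      gcongr
      show K3 ≤ K
      linarith)
    (by
      intro y
      simp_rw [fun z => hpow z (2 + 2 * κ) (by positivity)]
      refine (est_c hGm hG1 hε hG (by linarith) y).trans (ENNReal.ofReal_le_ofReal ?_)
      rw [show 2 + 2 * κ - 1 = 1 + 2 * κ by ring]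
      gcongr
      linarith)
    (by
      intro x
      simp_rw [fun z => hpow z (2 + 2 * κ) (by positivity)]
      refine (est_d hGm hG1 hε hκ hκ1 hG x).trans (ENNReal.ofReal_le_ofReal ?_)
      gcongr
      show K2 ≤ K
      linarith) g h hg hh hΓ hH
  set P0 := (2 + 2 * κ) * (2 - U - V) with hP0
  have hP0n : 0 ≤ P0 := mul_nonneg (by positivity) (by linarith)
  have hU' : 0 ≤ 1 - U := by linarith
  have hV' : 0 ≤ 1 - V := by linarith
  calc _ ≤ ∫⁻ z : ℝ × ℝ, ENNReal.ofReal (ε ^ (q - P0)) * (φ z ^ P0 * (g z.1 ^ U * h z.2 ^ V)) := by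
        refine lintegral_mono (fun z => ?_)
        simp only
        rw [← mul_assoc (ENNReal.ofReal (ε ^ (q - P0))), hpow z P0 hP0n, ← ENNReal.ofReal_mul (by positivity)]
        gcongr
        have h4 := TT_bound hε.le hG z.1 z.2
        rcases (norm_nonneg (TT G z.1 z.2)).eq_or_lt with h0 | h0
        · rw [← h0, zero_rpow hq.ne']; positivity
        calc ‖TT G z.1 z.2‖ ^ q = ‖TT G z.1 z.2‖ ^ (q - P0) * ‖TT G z.1 z.2‖ ^ P0 := by
              rw [← rpow_add h0]; norm_num
          _ ≤ _ := by gcongr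
    _ ≤ _ := by
        rw [lintegral_const_mul' _ _ ENNReal.ofReal_ne_top]
        refine (mul_le_mul_right main _).trans ?_
        rw [← ENNReal.ofReal_mul (by positivity), ← ENNReal.ofReal_mul (by positivity),
          ← ENNReal.ofReal_mul (by positivity), ENNReal.ofReal_rpow_of_pos (by positivity),
          ENNReal.ofReal_rpow_of_pos (by positivity), ENNReal.ofReal_rpow_of_pos (by positivity),
          ENNReal.ofReal_rpow_of_pos (by positivity), ← ENNReal.ofReal_mul (by positivity),
          ← ENNReal.ofReal_mul (by positivity), ← ENNReal.ofReal_mul (by positivity),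
          ← ENNReal.ofReal_mul (by positivity)]
        refine ENNReal.ofReal_le_ofReal ?_
        have e : ∀ a b c : ℝ, (K * ε ^ a * b) ^ c = K ^ c * (ε ^ (a * c)) * b ^ c ∨ b < 0 := by
          intro a b c
          rcases lt_or_ge b 0 with hb | hb
          · exact Or.inr hb
          · left
            rw [mul_rpow (by positivity) hb, mul_rpow hKpos.le (by positivity), ← rpow_mul hε.le]
        have e0 := (e (1 + 4 * κ) 1 ((1 - U) * (1 - V))).resolve_right (by norm_num)
        rw [mul_one, one_rpow, mul_one] at e0
        rw [e0, (e _ H _).resolve_right (by linarith), (e _ Γ _).resolve_right (by linarith),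
          mul_rpow hΓ0.le hH0.le]
        have eΓ : Γ ^ U = Γ ^ (U * (1 - V)) * Γ ^ (U * V) := by
          rw [← rpow_add hΓ0]; congr 1; ring
        have eH : H ^ V = H ^ (V * (1 - U)) * H ^ (U * V) := by
          rw [← rpow_add hH0]; congr 1; ring
        have eε : ε ^ (q - 3 + U + 2 * V) = ε ^ (q - P0) * (ε ^ ((1 + 4 * κ) * ((1 - U) * (1 - V))) *
          ε ^ ((1 + 2 * κ) * (V * (1 - U))) * ε ^ (2 * κ * (U * (1 - V)))) := by
          rw [← rpow_add hε, ← rpow_add hε, ← rpow_add hε]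
          congr 1
          rw [hP0]
          ring
        have eK : K ^ ((1 - U) * (1 - V)) * K ^ (V * (1 - U)) * K ^ (U * (1 - V)) ≤ K := by
          rw [← rpow_add hKpos, ← rpow_add hKpos]
          calc _ ≤ K ^ (1:ℝ) := by
                apply rpow_le_rpow_of_exponent_le (by linarith)
                nlinarith [mul_nonneg hU0 hV0]
            _ = K := rpow_one K
        rw [eΓ, eH, eε]
        calc _ = (K ^ ((1 - U) * (1 - V)) * K ^ (V * (1 - U)) * K ^ (U * (1 - V))) *
              (ε ^ (q - P0) * (ε ^ ((1 + 4 * κ) * ((1 - U) * (1 - V))) *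
          ε ^ ((1 + 2 * κ) * (V * (1 - U))) * ε ^ (2 * κ * (U * (1 - V))))) *
              (Γ ^ (U * (1 - V)) * Γ ^ (U * V)) * (H ^ (V * (1 - U)) * H ^ (U * V)) := by ring
          _ ≤ _ := by gcongr

lemma ae_ne_zero_real : ∀ᵐ u : ℝ, u ≠ 0 := by
  rw [ae_iff]
  simp

lemma one_add_le {u σ : ℝ} (hu : u ≠ 0) (hσ : 0 ≤ σ) : (1 + |u|) ^ (-σ) ≤ |u| ^ (-σ) :=
  rpow_le_rpow_of_nonpos (abs_pos.2 hu) (by linarith) (by linarith)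

lemma Hpow {c Y V s : ℝ} (hc : 0 < c) (hY : 0 < Y) (hV : 0 < V) :
    (c * Y ^ (1 - s / V)) ^ V = c ^ V * Y ^ (V - s) := by
  rw [mul_rpow hc.le (by positivity), ← rpow_mul hY.le]
  congr 2
  field_simp

lemma wsplit {s η : ℝ} (hs0 : 0 ≤ s) (hs1 : s < 1) (hη : 0 < η) :
    ∃ C V1 V2 : ℝ, 0 < C ∧ 0 ≤ V1 ∧ V1 ≤ 1 ∧ s - η ≤ V1 ∧ 0 ≤ V2 ∧ V2 ≤ 1 ∧ s - η ≤ V2 ∧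
    ∀ Y : ℝ, 0 < Y → ∃ (h1 h2 : ℝ → ℝ≥0∞) (H1 H2 : ℝ), Measurable h1 ∧ Measurable h2 ∧
      0 < H1 ∧ 0 < H2 ∧ ∫⁻ y, h1 y ≤ ENNReal.ofReal H1 ∧ ∫⁻ y, h2 y ≤ ENNReal.ofReal H2 ∧
      H1 ^ V1 ≤ C * Y ^ (V1 - s) ∧ H2 ^ V2 ≤ C * Y ^ (V2 - s) ∧
      ∀ y, ENNReal.ofReal ((1 + |y|) ^ (-s)) ≤ h1 y ^ V1 + h2 y ^ V2 := by
  rcases hs0.eq_or_lt with rfl | hs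
  · refine ⟨1, 0, 0, one_pos, le_rfl, zero_le_one, by linarith, le_rfl, zero_le_one, by linarith, ?_⟩
    intro Y hY
    refine ⟨0, 0, 1, 1, measurable_const, measurable_const, one_pos, one_pos, by simp, by simp,
      by simp, by simp, by simp⟩
  obtain ⟨η', hη'0, h1, h2, h3⟩ : ∃ η' : ℝ, 0 < η' ∧ η' ≤ η ∧ η' ≤ s / 2 ∧ η' ≤ (1 - s) / 2 :=
    ⟨min η (min (s / 2) ((1 - s) / 2)), by
      refine lt_min hη (lt_min (by linarith) (by linarith)), min_le_left _ _,
      (min_le_right _ _).trans (min_le_left _ _), (min_le_right _ _).trans (min_le_right _ _)⟩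
  set V1 := s + η' with hV1
  set V2 := s - η' with hV2
  have p1 : 0 < V1 := by linarith
  have p2 : 0 < V2 := by linarith
  have q1 : s / V1 < 1 := (div_lt_one p1).2 (by linarith)
  have q2 : 1 < s / V2 := (one_lt_div p2).2 (by linarith)
  set c1 := 2 / (1 - s / V1) with hc1
  set c2 := 2 / (s / V2 - 1) with hc2
  have c1p : 0 < c1 := div_pos two_pos (by linarith)
  have c2p : 0 < c2 := div_pos two_pos (by linarith)
  have r1 : 0 < c1 ^ V1 := by positivity
  have r2 : 0 < c2 ^ V2 := by positivity
  refine ⟨c1 ^ V1 + c2 ^ V2, V1, V2, by positivity, p1.le, by linarith, by linarith, p2.le,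
    by linarith, by linarith, ?_⟩
  intro Y hY
  have hm : ∀ σ : ℝ, Measurable (fun y : ℝ => ENNReal.ofReal ((1 + |y|) ^ σ)) := fun σ =>
    ((measurable_const.add measurable_id.abs).pow_const σ).ennreal_ofReal
  have hset1 : MeasurableSet {y : ℝ | |y| ≤ Y} := measurableSet_le measurable_id.abs measurable_const
  have hset2 : MeasurableSet {y : ℝ | Y < |y|} := measurableSet_lt measurable_const measurable_id.abs
  refine ⟨fun y => if |y| ≤ Y then ENNReal.ofReal ((1 + |y|) ^ (-(s / V1))) else 0,
    fun y => if Y < |y| then ENNReal.ofReal ((1 + |y|) ^ (-(s / V2))) else 0,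
    c1 * Y ^ (1 - s / V1), c2 * Y ^ (1 - s / V2), Measurable.ite hset1 (hm _) measurable_const,
    Measurable.ite hset2 (hm _) measurable_const, by positivity, by positivity, ?_, ?_, ?_, ?_, ?_⟩
  · calc _ ≤ ∫⁻ u, (if |u| ≤ Y then ENNReal.ofReal (|u| ^ (-(s / V1))) else 0) := by
          refine lintegral_mono_ae ?_
          filter_upwards [ae_ne_zero_real] with u hu
          split_ifs
          · exact ENNReal.ofReal_le_ofReal (one_add_le hu (by positivity))
          · exact le_rfl
      _ = _ := by
          rw [pw_in2 (by linarith) hY.le, show (2 : ℝ≥0∞) = ENNReal.ofReal 2 by simp,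
            ← ENNReal.ofReal_mul (by positivity)]
          congr 1
          rw [hc1, show -(s / V1) + 1 = 1 - s / V1 by ring]
          ring
  · calc _ ≤ ∫⁻ u, (if Y < |u| then ENNReal.ofReal (|u| ^ (-(s / V2))) else 0) := by
          refine lintegral_mono_ae ?_
          filter_upwards [ae_ne_zero_real] with u hu
          split_ifs
          · exact ENNReal.ofReal_le_ofReal (one_add_le hu (by positivity))
          · exact le_rfl
      _ = _ := by
          rw [pw_out2 (by linarith) hY, show (2 : ℝ≥0∞) = ENNReal.ofReal 2 by simp,
            ← ENNReal.ofReal_mul (by positivity)]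
          congr 1
          rw [hc2, show -(s / V2) + 1 = 1 - s / V2 by ring,
            show - -(s / V2) - 1 = s / V2 - 1 by ring]
          ring
  · rw [Hpow c1p hY p1]
    gcongr
    linarith
  · rw [Hpow c2p hY p2]
    gcongr
    linarith
  · intro y
    have e : ∀ V, 0 < V → (ENNReal.ofReal ((1 + |y|) ^ (-(s / V)))) ^ V =
        ENNReal.ofReal ((1 + |y|) ^ (-s)) := by
      intro V hV
      rw [ENNReal.ofReal_rpow_of_pos (by positivity), ← rpow_mul (by positivity)]
      congr 2
      field_simp
    simp only
    by_cases hy : |y| ≤ Y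
    · simp only [hy, if_true]
      rw [e V1 p1]
      exact le_self_add
    · simp only [not_le.1 hy, if_true]
      rw [e V2 p2]
      exact le_add_self

lemma lint_add4 {Z : Type*} [MeasurableSpace Z] (μ : Measure Z) (a b c d : Z → ℝ≥0∞)
    (ha : Measurable a) (hb : Measurable b) (hc : Measurable c) :
    ∫⁻ z, (a z + b z) + (c z + d z) ∂μ =
      (∫⁻ z, a z ∂μ + ∫⁻ z, b z ∂μ) + (∫⁻ z, c z ∂μ + ∫⁻ z, d z ∂μ) := by
  have h : Measurable (fun z => a z + b z) := ha.add hb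
  rw [lintegral_add_left h, lintegral_add_left ha, lintegral_add_left hc]

lemma strong_restricted {q s1 s2 : ℝ} (hq : 0 < q) (h10 : 0 ≤ s1) (h11 : s1 < 1) (h20 : 0 ≤ s2)
    (h21 : s2 < 1) (hd : 2 * (2 - s1 - s2) < q) : ∃ C : ℝ, 0 < C ∧
    ∀ (G : ℝ → ℂ) (ε : ℝ), Measurable G → (∀ θ, ‖G θ‖ ≤ 1) → 0 < ε →
    (∫⁻ θ in arc, ‖G θ‖ₑ ≤ ENNReal.ofReal ε) →
    ∫⁻ z : ℝ × ℝ, ENNReal.ofReal (‖TT G z.1 z.2‖ ^ q) *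
      (ENNReal.ofReal ((1 + |z.1|) ^ (-s1)) * ENNReal.ofReal ((1 + |z.2|) ^ (-s2))) ≤
      ENNReal.ofReal (C * ε ^ (q - 3 + s1 + 2 * s2)) := by
  set d := 2 - s1 - s2 with hdd
  have hdp : 0 < d := by linarith
  set η := (q - 2 * d) / 8 with hηd
  have hη : 0 < η := by linarith
  have hdη : d + 2 * η < q / 2 := by linarith
  have hdη0 : 0 < d + 2 * η := by linarith
  obtain ⟨κ, hκ, hκ1, hκq⟩ : ∃ κ : ℝ, 0 < κ ∧ κ < 1 ∧ (2 + 2 * κ) * (d + 2 * η) ≤ q := by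
    refine ⟨min (1 / 2) (q / 2 / (d + 2 * η) - 1), lt_min (by norm_num) ?_,
      lt_of_le_of_lt (min_le_left _ _) (by norm_num), ?_⟩
    · have := (one_lt_div hdη0).2 hdη
      linarith
    · have h := min_le_right (1 / 2) (q / 2 / (d + 2 * η) - 1)
      calc _ ≤ (2 + 2 * (q / 2 / (d + 2 * η) - 1)) * (d + 2 * η) := by gcongr
        _ = q := by field_simp; ring
  obtain ⟨K, hK1, hK⟩ := core_interp hκ hκ1
  obtain ⟨C1, U1, U2, hC1, hU10, hU11, hU1, hU20, hU21, hU2, hUs⟩ := wsplit h10 h11 hη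
  obtain ⟨C2, V1, V2, hC2, hV10, hV11, hV1, hV20, hV21, hV2, hVs⟩ := wsplit h20 h21 hη
  have hKp : 0 < K := by linarith
  refine ⟨4 * (K * C1 * C2), by positivity, ?_⟩
  intro G ε hGm hG1 hε hG
  obtain ⟨g1, g2, Γ1, Γ2, mg1, mg2, pΓ1, pΓ2, ig1, ig2, bΓ1, bΓ2, hgs⟩ := hUs (ε ^ (-1:ℝ)) (by positivity)
  obtain ⟨k1, k2, H1, H2, mk1, mk2, pH1, pH2, ik1, ik2, bH1, bH2, hks⟩ := hVs (ε ^ (-2:ℝ)) (by positivity)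
  have comb : ∀ (g h : ℝ → ℝ≥0∞) (Γ H U V : ℝ), Measurable g → Measurable h → 0 < Γ → 0 < H →
      ∫⁻ x, g x ≤ ENNReal.ofReal Γ → ∫⁻ y, h y ≤ ENNReal.ofReal H → 0 ≤ U → U ≤ 1 → s1 - η ≤ U →
      0 ≤ V → V ≤ 1 → s2 - η ≤ V → Γ ^ U ≤ C1 * (ε ^ (-1:ℝ)) ^ (U - s1) →
      H ^ V ≤ C2 * (ε ^ (-2:ℝ)) ^ (V - s2) →
      ∫⁻ z : ℝ × ℝ, ENNReal.ofReal (‖TT G z.1 z.2‖ ^ q) * (g z.1 ^ U * h z.2 ^ V) ≤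
        ENNReal.ofReal (K * C1 * C2 * ε ^ (q - 3 + s1 + 2 * s2)) := by
    intro g h Γ H U V mg mh pΓ pH ig ih U0 U1 Us V0 V1 Vs bΓ bH
    refine (hK G ε q U V g h Γ H hGm hG1 hε hG hq U0 U1 V0 V1 ?_ mg mh pΓ pH ig ih).trans
      (ENNReal.ofReal_le_ofReal ?_)
    · refine le_trans ?_ hκq
      gcongr
      linarith
    · calc _ ≤ K * ε ^ (q - 3 + U + 2 * V) * (C1 * (ε ^ (-1:ℝ)) ^ (U - s1)) *
            (C2 * (ε ^ (-2:ℝ)) ^ (V - s2)) := by gcongr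
        _ = K * C1 * C2 * (ε ^ (q - 3 + U + 2 * V) * (ε ^ (-1:ℝ)) ^ (U - s1) *
            (ε ^ (-2:ℝ)) ^ (V - s2)) := by ring
        _ = _ := by
          congr 1
          rw [← rpow_mul hε.le, ← rpow_mul hε.le, ← rpow_add hε, ← rpow_add hε]
          congr 1
          ring
  have mT : Measurable (fun z : ℝ × ℝ => ENNReal.ofReal (‖TT G z.1 z.2‖ ^ q)) :=
    ((TT_meas hGm).norm.pow_const q).ennreal_ofReal
  have mm : ∀ (g h : ℝ → ℝ≥0∞) (U V : ℝ), Measurable g → Measurable h → Measurable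
      (fun z : ℝ × ℝ => ENNReal.ofReal (‖TT G z.1 z.2‖ ^ q) * (g z.1 ^ U * h z.2 ^ V)) :=
    fun g h U V mg mh => mT.mul (((mg.comp measurable_fst).pow_const U).mul
      ((mh.comp measurable_snd).pow_const V))
  have a11 := comb g1 k1 Γ1 H1 U1 V1 mg1 mk1 pΓ1 pH1 ig1 ik1 hU10 hU11 hU1 hV10 hV11 hV1 bΓ1 bH1
  have a12 := comb g1 k2 Γ1 H2 U1 V2 mg1 mk2 pΓ1 pH2 ig1 ik2 hU10 hU11 hU1 hV20 hV21 hV2 bΓ1 bH2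
  have a21 := comb g2 k1 Γ2 H1 U2 V1 mg2 mk1 pΓ2 pH1 ig2 ik1 hU20 hU21 hU2 hV10 hV11 hV1 bΓ2 bH1
  have a22 := comb g2 k2 Γ2 H2 U2 V2 mg2 mk2 pΓ2 pH2 ig2 ik2 hU20 hU21 hU2 hV20 hV21 hV2 bΓ2 bH2
  calc _ ≤ ∫⁻ z : ℝ × ℝ, (ENNReal.ofReal (‖TT G z.1 z.2‖ ^ q) * (g1 z.1 ^ U1 * k1 z.2 ^ V1) +
        ENNReal.ofReal (‖TT G z.1 z.2‖ ^ q) * (g1 z.1 ^ U1 * k2 z.2 ^ V2)) +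
        (ENNReal.ofReal (‖TT G z.1 z.2‖ ^ q) * (g2 z.1 ^ U2 * k1 z.2 ^ V1) +
        ENNReal.ofReal (‖TT G z.1 z.2‖ ^ q) * (g2 z.1 ^ U2 * k2 z.2 ^ V2)) := by
        refine lintegral_mono (fun z => ?_)
        simp only
        rw [← mul_add, ← mul_add, ← mul_add, ← mul_add, ← mul_add, ← add_mul]
        gcongr
        · exact hgs z.1
        · exact hks z.2
    _ ≤ _ := by
        refine (lint_add4 volume _ _ _ _ (mm _ _ _ _ mg1 mk1) (mm _ _ _ _ mg1 mk2)
          (mm _ _ _ _ mg2 mk1)).le.trans ?_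
        refine (add_le_add (add_le_add a11 a12) (add_le_add a21 a22)).trans (le_of_eq ?_)
        rw [← ENNReal.ofReal_add (by positivity) (by positivity),
          ← ENNReal.ofReal_add (by positivity) (by positivity)]
        congr 1
        ring

/-- Layer of `G` at height `t`. -/
def lay (G : ℝ → ℂ) (t : ℝ) (θ : ℝ) : ℂ := if t < ‖G θ‖ then G θ / (‖G θ‖ : ℂ) else 0

/-- Distribution function on the arc. -/
def dis (G : ℝ → ℂ) (t : ℝ) : ℝ≥0∞ := volume {θ ∈ arc | t < ‖G θ‖}

lemma lay_meas {G : ℝ → ℂ} (hG : Measurable G) :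
    Measurable (fun z : ℝ × ℝ => lay G z.1 z.2) := by
  unfold lay
  have h2 : Measurable (fun z : ℝ × ℝ => G z.2) := hG.comp measurable_snd
  refine Measurable.ite (measurableSet_lt measurable_fst h2.norm) ?_ measurable_const
  exact h2.div (Complex.measurable_ofReal.comp h2.norm)

lemma lay_norm (G : ℝ → ℂ) (t θ : ℝ) : ‖lay G t θ‖ ≤ 1 := by
  unfold lay
  split_ifs with h
  · rw [norm_div, Complex.norm_real, norm_norm]
    exact div_self_le_one _
  · simp

lemma lay_lint {G : ℝ → ℂ} (hG : Measurable G) (t : ℝ) :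
    ∫⁻ θ in arc, ‖lay G t θ‖ₑ ≤ dis G t := by
  have hm : MeasurableSet {θ | t < ‖G θ‖} := measurableSet_lt measurable_const hG.norm
  calc _ ≤ ∫⁻ θ in arc, {θ | t < ‖G θ‖}.indicator 1 θ := by
        refine lintegral_mono (fun θ => ?_)
        by_cases h : t < ‖G θ‖
        · have h' : θ ∈ {θ | t < ‖G θ‖} := h
          rw [indicator_of_mem h']
          exact enorm_le_one' (lay_norm G t θ)
        · simp [lay, h]
    _ = _ := by
        rw [lintegral_indicator_one hm, Measure.restrict_apply hm]
        unfold dis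
        congr 1
        ext θ
        exact and_comm

lemma dis_le (G : ℝ → ℂ) (t : ℝ) : dis G t ≤ ENNReal.ofReal 2 := by
  unfold dis
  calc _ ≤ volume arc := measure_mono (fun θ h => h.1)
    _ ≤ _ := by
      rw [arc, Real.volume_Ioc]
      apply ENNReal.ofReal_le_ofReal
      linarith [pi_le_four]

lemma dis_anti (G : ℝ → ℂ) : Antitone (dis G) := fun s t hst =>
  measure_mono (fun θ h => ⟨h.1, hst.trans_lt h.2⟩)

lemma lay_int (G : ℝ → ℂ) (θ : ℝ) : ∫ t in Ioi (0:ℝ), lay G t θ = G θ := by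
  have h1 : ∀ t, lay G t θ = (Iio ‖G θ‖).indicator (fun _ => G θ / (‖G θ‖ : ℂ)) t := by
    intro t
    by_cases h : t < ‖G θ‖ <;> simp [lay, h]
  simp_rw [h1]
  rw [integral_indicator measurableSet_Iio, Measure.restrict_restrict measurableSet_Iio,
    setIntegral_const, inter_comm, Ioi_inter_Iio, Measure.real, Real.volume_Ioo, sub_zero,
    ENNReal.toReal_ofReal (norm_nonneg _)]
  by_cases h : G θ = 0
  · simp [h]
  · rw [Complex.real_smul]
    have : (‖G θ‖ : ℂ) ≠ 0 := by simpa using h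
    field_simp

lemma TT_lay_meas {G : ℝ → ℂ} (hG : Measurable G) :
    Measurable (fun w : (ℝ × ℝ) × ℝ => TT (lay G w.2) w.1.1 w.1.2) := by
  have : StronglyMeasurable (Function.uncurry (fun (w : (ℝ × ℝ) × ℝ) θ =>
      lay G w.2 θ * ep (w.1.1 * sin θ + w.1.2 * cos θ))) :=
    (((lay_meas hG).comp ((measurable_snd.comp measurable_fst).prodMk measurable_snd)).mul
      (ep_meas (by fun_prop))).stronglyMeasurable
  exact this.integral_prod_right.measurable

lemma dis_le_pow (G : ℝ → ℂ) {ρ : ℝ} (hρ : 0 < ρ) (hρ1 : ρ ≤ 1) (t : ℝ) :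
    dis G t ≤ ENNReal.ofReal 2 * dis G t ^ ρ := by
  calc dis G t = dis G t ^ (1 - ρ) * dis G t ^ ρ := by
        rw [← ENNReal.rpow_add_of_nonneg _ _ (by linarith) hρ.le]; simp
    _ ≤ (ENNReal.ofReal 2) ^ (1 - ρ) * dis G t ^ ρ := by
        gcongr
        exact dis_le G t
    _ ≤ _ := by
        gcongr
        calc _ ≤ (ENNReal.ofReal 2) ^ (1:ℝ) :=
              ENNReal.rpow_le_rpow_of_exponent_le (by norm_num) (by linarith)
          _ = _ := by simp

lemma TT_le {G : ℝ → ℂ} (hG : Measurable G) {ρ : ℝ} (hρ : 0 < ρ) (hρ1 : ρ ≤ 1)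
    (hS : ∫⁻ t in Ioi (0:ℝ), dis G t ^ ρ ≠ ⊤) (x y : ℝ) :
    ‖TT G x y‖ₑ ≤ ∫⁻ t in Ioi (0:ℝ), ‖TT (lay G t) x y‖ₑ := by
  have hfa := IsFiniteMeasure.mk (μ := volume.restrict arc) (by simpa using arc_vol.lt_top)
  have hm : Measurable (Function.uncurry
      (fun θ t => lay G t θ * ep (x * sin θ + y * cos θ))) :=
    ((lay_meas hG).comp (measurable_snd.prodMk measurable_fst)).mul (ep_meas (by fun_prop))
  have hint : Integrable (Function.uncurry (fun θ t => lay G t θ * ep (x * sin θ + y * cos θ)))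
      ((volume.restrict arc).prod (volume.restrict (Ioi (0:ℝ)))) := by
    refine ⟨hm.aestronglyMeasurable, ?_⟩
    unfold HasFiniteIntegral
    rw [lintegral_prod_symm _ hm.enorm.aemeasurable]
    simp only [Function.uncurry, gep_enorm]
    calc _ ≤ ∫⁻ t in Ioi (0:ℝ), ENNReal.ofReal 2 * dis G t ^ ρ :=
          lintegral_mono (fun t => (lay_lint hG t).trans (dis_le_pow G hρ hρ1 t))
      _ < ⊤ := by
          rw [lintegral_const_mul' _ _ ENNReal.ofReal_ne_top]
          exact ENNReal.mul_lt_top ENNReal.ofReal_lt_top hS.lt_top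
  have h1 : TT G x y = ∫ t in Ioi (0:ℝ), TT (lay G t) x y := by
    unfold TT
    rw [← integral_integral_swap hint]
    congr 1
    ext θ
    rw [integral_mul_const, lay_int]
  rw [h1]
  exact enorm_integral_le_lintegral_enorm _

lemma jensen_aux {Z : Type*} [MeasurableSpace Z] (μ : Measure Z) (a B : Z → ℝ≥0∞)
    (ha : Measurable a) (hB : Measurable B) {q : ℝ} (hq : 1 ≤ q) (hBt : ∀ z, B z ≠ ⊤)
    (hB0 : ∀ z, B z = 0 → a z = 0) :
    (∫⁻ z, a z ∂μ) ^ q ≤ (∫⁻ z, a z ^ q * B z ^ (1 - q) ∂μ) * (∫⁻ z, B z ∂μ) ^ (q - 1) := by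
  have hq0 : 0 < q := by linarith
  have hi : 1 / q ≤ 1 := by rw [div_le_one hq0]; exact hq
  have h := ENNReal.lintegral_mul_norm_pow_le (μ := μ) (f := fun z => a z ^ q * B z ^ (1 - q))
    (g := B) ((ha.pow_const q).mul (hB.pow_const _)).aemeasurable hB.aemeasurable
    (p := 1 / q) (q := 1 - 1 / q) (by positivity) (by linarith) (by ring)
  have e : ∀ z, a z = (a z ^ q * B z ^ (1 - q)) ^ (1 / q) * B z ^ (1 - 1 / q) := by
    intro z
    by_cases h0 : B z = 0
    · rw [hB0 z h0, ENNReal.zero_rpow_of_pos hq0, zero_mul, ENNReal.zero_rpow_of_pos (by positivity),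
        zero_mul]
    · rw [ENNReal.mul_rpow_of_nonneg _ _ (by positivity), ← ENNReal.rpow_mul, ← ENNReal.rpow_mul,
        mul_assoc, ← ENNReal.rpow_add _ _ h0 (hBt z)]
      rw [show (1 - q) * (1 / q) + (1 - 1 / q) = 0 by field_simp; ring,
        show q * (1 / q) = 1 by field_simp]
      simp
  calc (∫⁻ z, a z ∂μ) ^ q = (∫⁻ z, (a z ^ q * B z ^ (1 - q)) ^ (1 / q) * B z ^ (1 - 1 / q) ∂μ) ^ q := by
        congr 1
        exact lintegral_congr e
    _ ≤ ((∫⁻ z, a z ^ q * B z ^ (1 - q) ∂μ) ^ (1 / q) * (∫⁻ z, B z ∂μ) ^ (1 - 1 / q)) ^ q := by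
        gcongr
    _ = _ := by
        rw [ENNReal.mul_rpow_of_nonneg _ _ hq0.le, ← ENNReal.rpow_mul, ← ENNReal.rpow_mul,
          show 1 / q * q = 1 by field_simp, show (1 - 1 / q) * q = q - 1 by field_simp,
          ENNReal.rpow_one]

lemma mink_gen {Z : Type*} [MeasurableSpace Z] (μ : Measure Z) [SFinite μ]
    (T : Z → ℝ → ℝ≥0∞) (f W : Z → ℝ≥0∞) (B : ℝ → ℝ≥0∞) (K : ℝ≥0∞) {q : ℝ} (hq : 1 ≤ q)
    (hT : Measurable (Function.uncurry T)) (hW : Measurable W) (hB : Measurable B)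
    (hBt : ∀ t, B t ≠ ⊤) (hK : K ≠ ⊤) (hzero : ∀ t, B t = 0 → ∀ z, T z t = 0)
    (hf : ∀ z, f z ≤ ∫⁻ t in Ioi (0:ℝ), T z t) (hS : ∫⁻ t in Ioi (0:ℝ), B t ≠ ⊤)
    (hrest : ∀ t, ∫⁻ z, T z t ^ q * W z ∂μ ≤ K * B t ^ q) :
    ∫⁻ z, f z ^ q * W z ∂μ ≤ K * (∫⁻ t in Ioi (0:ℝ), B t) ^ q := by
  have hq0 : 0 < q := by linarith
  have hpt : ∀ z, f z ^ q * W z ≤ (∫⁻ t in Ioi (0:ℝ), B t) ^ (q - 1) *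
      ∫⁻ t in Ioi (0:ℝ), T z t ^ q * B t ^ (1 - q) * W z := by
    intro z
    have hz : Measurable (T z) := hT.of_uncurry_left
    have hz2 : Measurable (fun t => T z t ^ q * B t ^ (1 - q)) :=
      (hz.pow_const q).mul (hB.pow_const _)
    rw [lintegral_mul_const _ hz2, ← mul_assoc]
    refine mul_le_mul_left ?_ _
    calc _ ≤ (∫⁻ t in Ioi (0:ℝ), T z t) ^ q := ENNReal.rpow_le_rpow (hf z) hq0.le
      _ ≤ _ := by
          rw [mul_comm]
          exact jensen_aux _ _ _ hz hB hq hBt (fun t ht => hzero t ht z)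
  have hF : Measurable (Function.uncurry (fun (z : Z) (t : ℝ) =>
      T z t ^ q * B t ^ (1 - q) * W z)) :=
    ((hT.pow_const q).mul ((hB.comp measurable_snd).pow_const _)).mul (hW.comp measurable_fst)
  calc _ ≤ ∫⁻ z, (∫⁻ t in Ioi (0:ℝ), B t) ^ (q - 1) *
        (∫⁻ t in Ioi (0:ℝ), T z t ^ q * B t ^ (1 - q) * W z) ∂μ := lintegral_mono hpt
    _ = (∫⁻ t in Ioi (0:ℝ), B t) ^ (q - 1) * ∫⁻ t in Ioi (0:ℝ), ∫⁻ z,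
        T z t ^ q * B t ^ (1 - q) * W z ∂μ := by
        rw [lintegral_const_mul' _ _ (ENNReal.rpow_ne_top_of_nonneg (by linarith) hS),
          lintegral_lintegral_swap hF.aemeasurable]
    _ ≤ (∫⁻ t in Ioi (0:ℝ), B t) ^ (q - 1) * ∫⁻ t in Ioi (0:ℝ), K * B t := by
        refine mul_le_mul_right (lintegral_mono fun t => ?_) _
        by_cases h0 : B t = 0
        · simp [hzero t h0, hq0]
        · have e : ∀ z, T z t ^ q * B t ^ (1 - q) * W z =
              B t ^ (1 - q) * (T z t ^ q * W z) := fun z => by ring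
          simp_rw [e]
          rw [lintegral_const_mul' _ _ (ENNReal.rpow_ne_top_of_ne_zero h0 (hBt t))]
          calc _ ≤ B t ^ (1 - q) * (K * B t ^ q) := mul_le_mul_right (hrest t) _
            _ = K * (B t ^ (1 - q) * B t ^ q) := by ring
            _ = _ := by
                rw [← ENNReal.rpow_add _ _ h0 (hBt t)]
                simp
    _ = _ := by
        rw [lintegral_const_mul' _ _ hK, ← mul_assoc, mul_comm (_ ^ (q - 1)), mul_assoc]
        congr 1
        nth_rewrite 2 [← ENNReal.rpow_one (∫⁻ t in Ioi (0:ℝ), B t)]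
        rw [← ENNReal.rpow_add_of_nonneg _ _ (by linarith) zero_le_one, sub_add_cancel]

lemma TT_zero_of_dis {G : ℝ → ℂ} (hG : Measurable G) {ρ : ℝ} (hρ : 0 < ρ) (t : ℝ)
    (ht : dis G t ^ ρ = 0) (z : ℝ × ℝ) : TT (lay G t) z.1 z.2 = 0 := by
  have h0 : dis G t = 0 := by
    rcases ENNReal.rpow_eq_zero_iff.1 ht with h | h
    · exact h.1
    · linarith [h.2]
  have h1 : ‖TT (lay G t) z.1 z.2‖ ≤ 0 := TT_bound le_rfl
    ((lay_lint hG t).trans (by rw [h0]; simp)) _ _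
  exact norm_le_zero_iff.1 h1

lemma dis_pow_aux {G : ℝ → ℂ} {C E q ρ : ℝ} (hC : 0 < C) (hq : 0 < q)
    (h : q * ρ ≤ E) (t : ℝ) (hε : 0 < (dis G t).toReal) :
    ENNReal.ofReal (C * (dis G t).toReal ^ E) ≤
      ENNReal.ofReal (C * 2 ^ (E - q * ρ)) * (dis G t ^ ρ) ^ q := by
  have hdt : dis G t ≠ ⊤ := ((dis_le G t).trans_lt ENNReal.ofReal_lt_top).ne
  have hεe : dis G t = ENNReal.ofReal (dis G t).toReal := (ENNReal.ofReal_toReal hdt).symm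
  have hε2 : (dis G t).toReal ≤ 2 := by
    have := dis_le G t
    rw [hεe] at this
    exact (ENNReal.ofReal_le_ofReal_iff (by norm_num)).1 this
  generalize (dis G t).toReal = ε at *
  rw [hεe, ENNReal.ofReal_rpow_of_pos hε, ENNReal.ofReal_rpow_of_pos (by positivity),
    ← ENNReal.ofReal_mul (by positivity)]
  apply ENNReal.ofReal_le_ofReal
  rw [mul_assoc, ← rpow_mul hε.le]
  refine mul_le_mul_of_nonneg_left ?_ hC.le
  calc ε ^ E = ε ^ (E - q * ρ) * ε ^ (ρ * q) := by
        rw [← rpow_add hε]; congr 1; ring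
    _ ≤ _ := mul_le_mul_of_nonneg_right (rpow_le_rpow hε.le hε2 (by linarith)) (by positivity)

lemma strongS {q s1 s2 ρ : ℝ} (hq : 1 ≤ q) (h10 : 0 ≤ s1) (h11 : s1 < 1) (h20 : 0 ≤ s2)
    (h21 : s2 < 1) (hd : 2 * (2 - s1 - s2) < q) (hρ : 0 < ρ) (hρ1 : ρ ≤ 1)
    (hρq : q * ρ ≤ q - 3 + s1 + 2 * s2) : ∃ C : ℝ, 0 < C ∧
    ∀ (G : ℝ → ℂ), Measurable G →
    ∫⁻ z : ℝ × ℝ, ‖TT G z.1 z.2‖ₑ ^ q *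
      (ENNReal.ofReal ((1 + |z.1|) ^ (-s1)) * ENNReal.ofReal ((1 + |z.2|) ^ (-s2))) ≤
      ENNReal.ofReal C * (∫⁻ t in Ioi (0:ℝ), dis G t ^ ρ) ^ q := by
  have hq0 : 0 < q := by linarith
  obtain ⟨C, hC, hCs⟩ := strong_restricted hq0 h10 h11 h20 h21 hd
  refine ⟨C * 2 ^ (q - 3 + s1 + 2 * s2 - q * ρ), by positivity, ?_⟩
  intro G hG
  by_cases hS : (∫⁻ t in Ioi (0:ℝ), dis G t ^ ρ) = ⊤
  · rw [hS, ENNReal.top_rpow_of_pos hq0, ENNReal.mul_top]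
    · exact le_top
    · exact (ENNReal.ofReal_pos.2 (by positivity)).ne'
  have hWm : Measurable (fun z : ℝ × ℝ => ENNReal.ofReal ((1 + |z.1|) ^ (-s1)) *
      ENNReal.ofReal ((1 + |z.2|) ^ (-s2))) :=
    (((measurable_const.add measurable_fst.abs).pow_const _).ennreal_ofReal).mul
      (((measurable_const.add measurable_snd.abs).pow_const _).ennreal_ofReal)
  have hBm : Measurable (fun t => dis G t ^ ρ) := (dis_anti G).measurable.pow_const ρ
  have hdt : ∀ t, dis G t ≠ ⊤ := fun t => ((dis_le G t).trans_lt ENNReal.ofReal_lt_top).ne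
  have hBt : ∀ t, dis G t ^ ρ ≠ ⊤ := fun t => ENNReal.rpow_ne_top_of_nonneg hρ.le (hdt t)
  have hlm : ∀ t, Measurable (lay G t) := fun t => (lay_meas hG).of_uncurry_left (f := lay G)
  have hTm : Measurable (Function.uncurry (fun (z : ℝ × ℝ) (t : ℝ) =>
    ‖TT (lay G t) z.1 z.2‖ₑ)) := (TT_lay_meas hG).enorm
  have hf : ∀ z : ℝ × ℝ, ‖TT G z.1 z.2‖ₑ ≤ ∫⁻ t in Ioi (0:ℝ), ‖TT (lay G t) z.1 z.2‖ₑ :=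
    fun z => TT_le hG hρ hρ1 hS z.1 z.2
  have hzero : ∀ t, dis G t ^ ρ = 0 → ∀ z : ℝ × ℝ, ‖TT (lay G t) z.1 z.2‖ₑ = 0 := by
    intro t ht z
    rw [TT_zero_of_dis hG hρ t ht z, enorm_zero]
  have hrest : ∀ t, ∫⁻ z : ℝ × ℝ, ‖TT (lay G t) z.1 z.2‖ₑ ^ q *
      (ENNReal.ofReal ((1 + |z.1|) ^ (-s1)) * ENNReal.ofReal ((1 + |z.2|) ^ (-s2))) ≤
      ENNReal.ofReal (C * 2 ^ (q - 3 + s1 + 2 * s2 - q * ρ)) * (dis G t ^ ρ) ^ q := by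
    intro t
    by_cases h0 : dis G t = 0
    · have hz := TT_zero_of_dis hG hρ t (by rw [h0, ENNReal.zero_rpow_of_pos hρ])
      simp only [hz, enorm_zero, ENNReal.zero_rpow_of_pos hq0, zero_mul, lintegral_zero]
      exact zero_le
    · have hε : 0 < (dis G t).toReal := ENNReal.toReal_pos h0 (hdt t)
      have h5 := hCs (lay G t) _ (hlm t) (lay_norm G t) hε
        ((ENNReal.ofReal_toReal (hdt t)).symm ▸ lay_lint hG t)
      refine le_trans (le_of_eq ?_) (h5.trans (dis_pow_aux hC hq0 hρq t hε))
      refine lintegral_congr (fun z => ?_)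
      rw [← ofReal_norm, ENNReal.ofReal_rpow_of_nonneg (norm_nonneg _) hq0.le]
  generalize hWd : (fun z : ℝ × ℝ => ENNReal.ofReal ((1 + |z.1|) ^ (-s1)) *
      ENNReal.ofReal ((1 + |z.2|) ^ (-s2))) = W at hWm
  have hW' : ∀ z : ℝ × ℝ, ENNReal.ofReal ((1 + |z.1|) ^ (-s1)) *
      ENNReal.ofReal ((1 + |z.2|) ^ (-s2)) = W z := fun z => congrFun hWd z
  simp only [hW'] at hrest ⊢
  have key := mink_gen (volume : Measure (ℝ × ℝ)) (fun z t => ‖TT (lay G t) z.1 z.2‖ₑ)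
    (fun z => ‖TT G z.1 z.2‖ₑ) W (fun t => dis G t ^ ρ)
    (ENNReal.ofReal (C * 2 ^ (q - 3 + s1 + 2 * s2 - q * ρ))) hq hTm hWm hBm hBt
    ENNReal.ofReal_ne_top hzero hf hS hrest
  exact key

lemma sec_bound {A B l x : ℝ} (hB : 0 < B) (hA : 0 ≤ A) (hl : 0 < l) (hx : x ≠ 0) {s : Set ℝ}
    (hs : ∀ y ∈ s, (1 + |x|) ^ A * (1 + |y|) ^ B ≤ l) :
    volume s ≤ ENNReal.ofReal (|x| ^ (-A / B)) * ENNReal.ofReal (2 * l ^ (1 / B)) := by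
  have hx0 : 0 < |x| := abs_pos.2 hx
  have hsub : s ⊆ Icc (-(l ^ (1 / B) * |x| ^ (-A / B))) (l ^ (1 / B) * |x| ^ (-A / B)) := by
    intro y hy
    rw [mem_Icc, ← abs_le]
    have h1 := hs y hy
    have h2 : |x| ^ A * |y| ^ B ≤ l := by
      refine le_trans ?_ h1
      gcongr <;> linarith [abs_nonneg x, abs_nonneg y]
    have h3 : |y| ^ B ≤ l * |x| ^ (-A) := by
      rw [rpow_neg hx0.le, ← div_eq_mul_inv, le_div_iff₀ (by positivity)]
      linarith
    have h4 := rpow_le_rpow (by positivity) h3 (by positivity : 0 ≤ 1 / B)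
    rw [← rpow_mul (abs_nonneg y), mul_one_div_cancel hB.ne', rpow_one,
      mul_rpow hl.le (by positivity), ← rpow_mul hx0.le] at h4
    rw [show -A / B = -A * (1 / B) by ring]
    exact h4
  calc volume s ≤ _ := measure_mono hsub
    _ = _ := by
      rw [Real.volume_Icc, ← ENNReal.ofReal_mul (by positivity)]
      congr 1
      ring

lemma subl {γ η : ℝ} (hη : 0 < η) (h : 2 * η < γ) : ∃ C : ℝ, 0 < C ∧ ∀ l : ℝ, 0 < l →
    volume {z : ℝ × ℝ | (1 + |z.1|) ^ (γ + 2 * η) * (1 + |z.2|) ^ (γ - η) ≤ l ∧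
      (1 + |z.1|) ^ (γ - 2 * η) * (1 + |z.2|) ^ (γ + η) ≤ l} ≤ ENNReal.ofReal (C * l ^ (1 / γ)) := by
  have hγ : 0 < γ := by linarith
  have hm : 0 < γ - η := by linarith
  have hp : 0 < γ + η := by linarith
  have e1 : 0 < -(γ - 2 * η) / (γ + η) + 1 := by
    rw [show -(γ - 2 * η) / (γ + η) + 1 = 3 * η / (γ + η) by field_simp; ring]
    positivity
  have e2 : -(γ + 2 * η) / (γ - η) + 1 < 0 := by
    rw [show -(γ + 2 * η) / (γ - η) + 1 = -(3 * η / (γ - η)) by field_simp; ring]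
    have : 0 < 3 * η / (γ - η) := by positivity
    linarith
  set c1 := -(γ - 2 * η) / (γ + η) with hc1
  set c2 := -(γ + 2 * η) / (γ - η) with hc2
  refine ⟨4 / (c1 + 1) + 4 / (-(c2 + 1)), by
    have : 0 < -(c2 + 1) := by linarith
    positivity, ?_⟩
  intro l hl
  set X := l ^ (1 / (3 * γ)) with hX
  have hX0 : 0 < X := by positivity
  have hms : MeasurableSet {z : ℝ × ℝ | (1 + |z.1|) ^ (γ + 2 * η) * (1 + |z.2|) ^ (γ - η) ≤ l ∧
      (1 + |z.1|) ^ (γ - 2 * η) * (1 + |z.2|) ^ (γ + η) ≤ l} := by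
    have hf : Measurable (fun z : ℝ × ℝ => 1 + |z.1|) := measurable_const.add measurable_fst.abs
    have hs : Measurable (fun z : ℝ × ℝ => 1 + |z.2|) := measurable_const.add measurable_snd.abs
    exact (measurableSet_le ((hf.pow_const _).mul (hs.pow_const _)) measurable_const).inter
      (measurableSet_le ((hf.pow_const _).mul (hs.pow_const _)) measurable_const)
  rw [Measure.volume_eq_prod, Measure.prod_apply hms]
  calc _ ≤ ∫⁻ x : ℝ, ((if |x| ≤ X then ENNReal.ofReal (|x| ^ c1) else 0) *
          ENNReal.ofReal (2 * l ^ (1 / (γ + η))) +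
        (if X < |x| then ENNReal.ofReal (|x| ^ c2) else 0) *
          ENNReal.ofReal (2 * l ^ (1 / (γ - η)))) := by
        refine lintegral_mono_ae ?_
        filter_upwards [ae_ne_zero_real] with x hx
        rcases le_or_gt |x| X with hxx | hxx
        · refine le_trans ?_ le_self_add
          rw [if_pos hxx]
          exact sec_bound hp (by linarith) hl hx (fun y hy => hy.2)
        · refine le_trans ?_ le_add_self
          rw [if_pos hxx]
          exact sec_bound hm (by linarith) hl hx (fun y hy => hy.1)
    _ = ENNReal.ofReal (2 * (X ^ (c1 + 1) / (c1 + 1))) * ENNReal.ofReal (2 * l ^ (1 / (γ + η))) +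
        ENNReal.ofReal (2 * (X ^ (c2 + 1) / (-(c2 + 1)))) * ENNReal.ofReal (2 * l ^ (1 / (γ - η))) := by
        have m1 : Measurable (fun x : ℝ => (if |x| ≤ X then ENNReal.ofReal (|x| ^ c1) else 0)) :=
          Measurable.ite (measurableSet_le measurable_id.abs measurable_const)
            (measurable_id.abs.pow_const c1).ennreal_ofReal measurable_const
        rw [lintegral_add_left (m1.mul_const _), lintegral_mul_const' _ _ ENNReal.ofReal_ne_top,
          lintegral_mul_const' _ _ ENNReal.ofReal_ne_top, pw_in2 (by linarith) hX0.le,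
          pw_out2 (by linarith) hX0, show -c2 - 1 = -(c2 + 1) by ring,
          ENNReal.ofReal_mul (p := 2) (q := X ^ (c1 + 1) / (c1 + 1)) zero_le_two,
          ENNReal.ofReal_mul (p := 2) (q := X ^ (c2 + 1) / (-(c2 + 1))) zero_le_two,
          ENNReal.ofReal_ofNat]
    _ = _ := by
        have hc2' : 0 < -(c2 + 1) := by linarith
        rw [← ENNReal.ofReal_mul (by positivity), ← ENNReal.ofReal_mul (by positivity),
          ← ENNReal.ofReal_add (by positivity) (by positivity)]
        congr 1
        have k1 : X ^ (c1 + 1) * l ^ (1 / (γ + η)) = l ^ (1 / γ) := by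
          rw [hX, ← rpow_mul hl.le, ← rpow_add hl]
          congr 1
          rw [hc1]; field_simp; ring
        have k2 : X ^ (c2 + 1) * l ^ (1 / (γ - η)) = l ^ (1 / γ) := by
          rw [hX, ← rpow_mul hl.le, ← rpow_add hl]
          congr 1
          rw [hc2]; field_simp; ring
        calc _ = 4 / (c1 + 1) * (X ^ (c1 + 1) * l ^ (1 / (γ + η))) +
              4 / (-(c2 + 1)) * (X ^ (c2 + 1) * l ^ (1 / (γ - η))) := by ring
          _ = _ := by rw [k1, k2]; ring

lemma cheb_gen {f : ℝ × ℝ → ℝ≥0∞} (hf : Measurable f) {Ω : Set (ℝ × ℝ)} {c B : ℝ} (hc : 0 < c)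
    (hΩ : ∀ z ∈ Ω, ENNReal.ofReal c ≤ f z) (hB : ∫⁻ z, f z ≤ ENNReal.ofReal B) :
    volume Ω ≤ ENNReal.ofReal (B / c) := by
  have h1 := mul_meas_ge_le_lintegral (μ := volume) hf (ENNReal.ofReal c)
  have h2 : volume Ω ≤ volume {z | ENNReal.ofReal c ≤ f z} := measure_mono hΩ
  rw [ENNReal.ofReal_div_of_pos hc, ENNReal.le_div_iff_mul_le
    (Or.inl (ENNReal.ofReal_pos.2 hc).ne') (Or.inl ENNReal.ofReal_ne_top), mul_comm]
  exact (mul_le_mul_right h2 _).trans (h1.trans hB)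

lemma TTW_meas {G : ℝ → ℂ} (hG : Measurable G) (q s1 s2 : ℝ) :
    Measurable (fun z : ℝ × ℝ => ‖TT G z.1 z.2‖ₑ ^ q *
      (ENNReal.ofReal ((1 + |z.1|) ^ (-s1)) * ENNReal.ofReal ((1 + |z.2|) ^ (-s2)))) := by
  have hf : Measurable (fun z : ℝ × ℝ => 1 + |z.1|) := measurable_const.add measurable_fst.abs
  have hs : Measurable (fun z : ℝ × ℝ => 1 + |z.2|) := measurable_const.add measurable_snd.abs
  exact ((TT_meas hG).enorm.pow_const q).mul
    ((hf.pow_const _).ennreal_ofReal.mul (hs.pow_const _).ennreal_ofReal)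

/-- Pointwise lower bound for the weighted integrand on the level set. -/
lemma lvl {v t X Y a b p s1 s2 l : ℝ} (hv : 0 ≤ v) (ht : 0 < t) (hX : 0 < X) (hY : 0 < Y)
    (hp : 0 < p) (h : t < v * (X ^ (-a) * Y ^ (-b))) (hl : l ≤ X ^ (p * a - s1) * Y ^ (p * b - s2)) :
    t ^ p * l ≤ v ^ p * (X ^ (-s1) * Y ^ (-s2)) := by
  have h1 : t * (X ^ a * Y ^ b) ≤ v := by
    rw [rpow_neg hX.le, rpow_neg hY.le, ← mul_inv, ← div_eq_mul_inv, lt_div_iff₀ (by positivity)] at h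
    exact h.le
  have h2 := rpow_le_rpow (by positivity) h1 hp.le
  rw [mul_rpow ht.le (by positivity), mul_rpow (by positivity) (by positivity), ← rpow_mul hX.le,
    ← rpow_mul hY.le] at h2
  calc t ^ p * l ≤ t ^ p * (X ^ (p * a - s1) * Y ^ (p * b - s2)) := by gcongr
    _ = t ^ p * (X ^ (a * p) * Y ^ (b * p)) * (X ^ (-s1) * Y ^ (-s2)) := by
      rw [show p * a - s1 = a * p + -s1 by ring, show p * b - s2 = b * p + -s2 by ring,
        rpow_add hX, rpow_add hY]
      ring
    _ ≤ _ := by gcongr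

lemma lvl_enn {G : ℝ → ℂ} {z : ℝ × ℝ} {t a b p s1 s2 l : ℝ} (ht : 0 < t) (hp : 0 < p)
    (h : t < ‖TT G z.1 z.2‖ * ((1 + |z.1|) ^ (-a) * (1 + |z.2|) ^ (-b)))
    (hl : l ≤ (1 + |z.1|) ^ (p * a - s1) * (1 + |z.2|) ^ (p * b - s2)) :
    ENNReal.ofReal (t ^ p * l) ≤ ‖TT G z.1 z.2‖ₑ ^ p *
      (ENNReal.ofReal ((1 + |z.1|) ^ (-s1)) * ENNReal.ofReal ((1 + |z.2|) ^ (-s2))) := by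
  rw [← ofReal_norm, ENNReal.ofReal_rpow_of_nonneg (norm_nonneg _) hp.le,
    ← ENNReal.ofReal_mul (by positivity), ← ENNReal.ofReal_mul (by positivity)]
  exact ENNReal.ofReal_le_ofReal (lvl (norm_nonneg _) ht (by positivity) (by positivity) hp h hl)

lemma weak_big {α β q ρ : ℝ} (hq : 1 ≤ q) (hα0 : 0 ≤ α) (hβ0 : 0 ≤ β) (hα : α < 1 / q)
    (hβ : β < 1 / q) (hρ : 0 < ρ) (hρ1 : ρ ≤ 1) (h1 : 2 / q - 1 / 2 < α + β)
    (h2 : 3 / q - (1 - ρ) ≤ α + 2 * β) : ∃ C : ℝ, 0 < C ∧ ∀ G : ℝ → ℂ, Measurable G →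
    ∀ d t : ℝ, 0 < d → 0 < t → ∫⁻ t in Ioi (0:ℝ), dis G t ^ ρ ≤ ENNReal.ofReal d →
    volume {z : ℝ × ℝ | t < ‖TT G z.1 z.2‖ * ((1 + |z.1|) ^ (-α) * (1 + |z.2|) ^ (-β))} ≤
      ENNReal.ofReal (C * (d / t) ^ q) := by
  have hq0 : 0 < q := by linarith
  have k1 : q * α < 1 := by rw [lt_div_iff₀ hq0] at hα; linarith
  have k2 : q * β < 1 := by rw [lt_div_iff₀ hq0] at hβ; linarith
  have k3 : 2 * (2 - q * α - q * β) < q := by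
    have : q * (2 / q - 1 / 2) < q * (α + β) := by gcongr
    have e : q * (2 / q - 1 / 2) = 2 - q / 2 := by field_simp
    linarith
  have k4 : q * ρ ≤ q - 3 + q * α + 2 * (q * β) := by
    have : q * (3 / q - (1 - ρ)) ≤ q * (α + 2 * β) := by gcongr
    have e : q * (3 / q - (1 - ρ)) = 3 - q + q * ρ := by field_simp; ring
    linarith
  obtain ⟨C, hC, hS⟩ := strongS hq (by positivity) k1 (by positivity) k2 k3 hρ hρ1 k4
  refine ⟨C, hC, fun G hG d t hd ht hdd => ?_⟩
  have h5 := cheb_gen (TTW_meas hG q (q * α) (q * β)) (c := t ^ q) (B := C * d ^ q)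
    (Ω := {z : ℝ × ℝ | t < ‖TT G z.1 z.2‖ * ((1 + |z.1|) ^ (-α) * (1 + |z.2|) ^ (-β))})
    (by positivity) ?_ ?_
  · refine h5.trans (le_of_eq ?_)
    rw [div_rpow hd.le ht.le, mul_div_assoc]
  · intro z hz
    have := lvl_enn (p := q) (s1 := q * α) (s2 := q * β) (l := 1) ht hq0 hz (by simp)
    rwa [mul_one] at this
  · refine (hS G hG).trans ?_
    rw [ENNReal.ofReal_mul hC.le, ← ENNReal.ofReal_rpow_of_pos hd]
    gcongr

lemma weak_small {α β q ρ : ℝ} (hq0 : 0 < q) (hq : q < 1) (hα : α < 1 / q)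
    (hβ : β < 1 / q) (hρ : 0 < ρ) (hρ1 : ρ ≤ 1) (h1 : 2 / q - 1 / 2 < α + β)
    (h2 : 3 / q - (1 - ρ) ≤ α + 2 * β) : ∃ C : ℝ, 0 < C ∧ ∀ G : ℝ → ℂ, Measurable G →
    ∀ d t : ℝ, 0 < d → 0 < t → ∫⁻ t in Ioi (0:ℝ), dis G t ^ ρ ≤ ENNReal.ofReal d →
    volume {z : ℝ × ℝ | t < ‖TT G z.1 z.2‖ * ((1 + |z.1|) ^ (-α) * (1 + |z.2|) ^ (-β))} ≤
      ENNReal.ofReal (C * (d / t) ^ q) := by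
  obtain ⟨Q, hQ⟩ : ∃ Q, Q = 1 / q := ⟨_, rfl⟩
  have hQ1 : 1 < Q := by rw [hQ, lt_div_iff₀ hq0]; linarith
  rw [show 2 / q = 2 * Q by rw [hQ]; ring] at h1
  rw [show 3 / q = 3 * Q by rw [hQ]; ring] at h2
  rw [← hQ] at hα hβ
  obtain ⟨η, hη, e1, e2, e3⟩ : ∃ η : ℝ, 0 < η ∧ 2 * η < Q - α ∧ η < Q - β ∧
      (Q - α) + (Q - β) + η < 1 / 2 := by
    have : 0 < min ((Q - α) / 2) (min (Q - β) (1 / 2 - ((Q - α) + (Q - β)))) := by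
      refine lt_min (by linarith) (lt_min (by linarith) (by linarith))
    obtain ⟨η, hη, hη2⟩ := exists_between this
    simp only [lt_min_iff] at hη2
    exact ⟨η, hη, by linarith [hη2.1], hη2.2.1, by linarith [hη2.2.2]⟩
  obtain ⟨C1, hC1, hS1⟩ := strongS (q := 2) (s1 := 1 - 2 * (Q - α) - 4 * η)
    (s2 := 1 - 2 * (Q - β) + 2 * η) (ρ := ρ) (by norm_num) (by linarith) (by linarith) (by linarith)
    (by linarith) (by linarith) hρ hρ1 (by linarith)
  obtain ⟨C2, hC2, hS2⟩ := strongS (q := 2) (s1 := 1 - 2 * (Q - α) + 4 * η)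
    (s2 := 1 - 2 * (Q - β) - 2 * η) (ρ := ρ) (by norm_num) (by linarith) (by linarith) (by linarith)
    (by linarith) (by linarith) hρ hρ1 (by linarith)
  obtain ⟨C3, hC3, hsub⟩ := subl (γ := 2 * Q - 1) (η := 2 * η) (by linarith) (by linarith)
  refine ⟨C3 + C1 + C2, by positivity, fun G hG d t hd ht hdd => ?_⟩
  set Ω := {z : ℝ × ℝ | t < ‖TT G z.1 z.2‖ * ((1 + |z.1|) ^ (-α) * (1 + |z.2|) ^ (-β))} with hΩ
  have hD : 0 < d / t := by positivity
  set l := (d / t) ^ (2 - q) with hl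
  have hl0 : 0 < l := by positivity
  have piece : ∀ (s1 s2 C : ℝ), 0 < C →
      ∫⁻ z : ℝ × ℝ, ‖TT G z.1 z.2‖ₑ ^ (2:ℝ) *
      (ENNReal.ofReal ((1 + |z.1|) ^ (-s1)) * ENNReal.ofReal ((1 + |z.2|) ^ (-s2))) ≤
      ENNReal.ofReal C * (∫⁻ t in Ioi (0:ℝ), dis G t ^ ρ) ^ (2:ℝ) →
      volume {z ∈ Ω | l < (1 + |z.1|) ^ (2 * α - s1) * (1 + |z.2|) ^ (2 * β - s2)} ≤
        ENNReal.ofReal (C * (d / t) ^ q) := by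
    intro s1 s2 C hC hI
    have h5 := cheb_gen (TTW_meas hG 2 s1 s2) (c := t ^ (2:ℝ) * l) (B := C * d ^ (2:ℝ))
      (Ω := {z ∈ Ω | l < (1 + |z.1|) ^ (2 * α - s1) * (1 + |z.2|) ^ (2 * β - s2)})
      (by positivity) ?_ ?_
    · refine h5.trans (le_of_eq ?_)
      congr 1
      rw [mul_div_assoc, ← div_div, ← div_rpow hd.le ht.le, hl, ← rpow_sub hD]
      congr 2
      ring
    · intro z hz
      exact lvl_enn ht (by norm_num) hz.1 hz.2.le
    · refine hI.trans ?_
      rw [ENNReal.ofReal_mul hC.le, ← ENNReal.ofReal_rpow_of_pos hd]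
      gcongr
  have hcov : Ω ⊆ ({z : ℝ × ℝ | (1 + |z.1|) ^ (2 * Q - 1 + 2 * (2 * η)) *
      (1 + |z.2|) ^ (2 * Q - 1 - 2 * η) ≤ l ∧ (1 + |z.1|) ^ (2 * Q - 1 - 2 * (2 * η)) *
      (1 + |z.2|) ^ (2 * Q - 1 + 2 * η) ≤ l} ∪
      {z ∈ Ω | l < (1 + |z.1|) ^ (2 * α - (1 - 2 * (Q - α) - 4 * η)) *
        (1 + |z.2|) ^ (2 * β - (1 - 2 * (Q - β) + 2 * η))}) ∪
      {z ∈ Ω | l < (1 + |z.1|) ^ (2 * α - (1 - 2 * (Q - α) + 4 * η)) *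
        (1 + |z.2|) ^ (2 * β - (1 - 2 * (Q - β) - 2 * η))} := by
    intro z hz
    rw [show 2 * α - (1 - 2 * (Q - α) - 4 * η) = 2 * Q - 1 + 2 * (2 * η) by ring,
      show 2 * β - (1 - 2 * (Q - β) + 2 * η) = 2 * Q - 1 - 2 * η by ring,
      show 2 * α - (1 - 2 * (Q - α) + 4 * η) = 2 * Q - 1 - 2 * (2 * η) by ring,
      show 2 * β - (1 - 2 * (Q - β) - 2 * η) = 2 * Q - 1 + 2 * η by ring]
    by_cases ha : (1 + |z.1|) ^ (2 * Q - 1 + 2 * (2 * η)) *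
      (1 + |z.2|) ^ (2 * Q - 1 - 2 * η) ≤ l
    · by_cases hb : (1 + |z.1|) ^ (2 * Q - 1 - 2 * (2 * η)) *
        (1 + |z.2|) ^ (2 * Q - 1 + 2 * η) ≤ l
      · exact Or.inl (Or.inl ⟨ha, hb⟩)
      · exact Or.inr ⟨hz, not_le.1 hb⟩
    · exact Or.inl (Or.inr ⟨hz, not_le.1 ha⟩)
  calc volume Ω ≤ _ := measure_mono hcov
    _ ≤ _ := measure_union_le _ _
    _ ≤ _ := add_le_add_left (measure_union_le _ _) _
    _ ≤ (ENNReal.ofReal (C3 * l ^ (1 / (2 * Q - 1))) + ENNReal.ofReal (C1 * (d / t) ^ q)) +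
        ENNReal.ofReal (C2 * (d / t) ^ q) := by
        refine add_le_add (add_le_add (hsub l hl0) (piece _ _ C1 hC1 (hS1 G hG)))
          (piece _ _ C2 hC2 (hS2 G hG))
    _ = _ := by
        have : l ^ (1 / (2 * Q - 1)) = (d / t) ^ q := by
          rw [hl, ← rpow_mul hD.le]
          congr 1
          rw [hQ]
          have : 2 - q ≠ 0 := by linarith
          field_simp
        rw [this, ← ENNReal.ofReal_add (by positivity) (by positivity),
          ← ENNReal.ofReal_add (by positivity) (by positivity)]
        congr 1
        ring

lemma weakT {α β q ρ : ℝ} (hq : 0 < q) (hα0 : 0 ≤ α) (hβ0 : 0 ≤ β) (hα : α < 1 / q)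
    (hβ : β < 1 / q) (hρ : 0 < ρ) (hρ1 : ρ ≤ 1) (h1 : 2 / q - 1 / 2 < α + β)
    (h2 : 3 / q - (1 - ρ) ≤ α + 2 * β) : ∃ C : ℝ, 0 < C ∧ ∀ G : ℝ → ℂ, Measurable G →
    ∀ d t : ℝ, 0 < d → 0 < t → ∫⁻ t in Ioi (0:ℝ), dis G t ^ ρ ≤ ENNReal.ofReal d →
    volume {z : ℝ × ℝ | t < ‖TT G z.1 z.2‖ * ((1 + |z.1|) ^ (-α) * (1 + |z.2|) ^ (-β))} ≤
      ENNReal.ofReal (C * (d / t) ^ q) := by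
  rcases le_or_gt 1 q with h | h
  · exact weak_big h hα0 hβ0 hα hβ hρ hρ1 h1 h2
  · exact weak_small hq h hα hβ hρ hρ1 h1 h2

/-- Translated quarter pieces of `F`. -/
def Gk (F : ℝ → ℂ) (k : ℕ) (θ : ℝ) : ℂ := (Ioc (0:ℝ) (2 * π)).indicator F (θ + k * (π / 2))

lemma Gk_meas {F : ℝ → ℂ} (hF : Measurable F) (k : ℕ) : Measurable (Gk F k) :=
  (hF.indicator measurableSet_Ioc).comp (measurable_id.add_const _)

lemma Gk_dis (F : ℝ → ℂ) (k : ℕ) {r : ℝ} (hr : 1 ≤ r) :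
    ∫⁻ t in Ioi (0:ℝ), dis (Gk F k) t ^ (1 / r) ≤ lorentz1 r F := by
  unfold lorentz1
  refine setLIntegral_mono' measurableSet_Ioi (fun t ht => ?_)
  have ht0 : (0:ℝ) < t := ht
  refine ENNReal.rpow_le_rpow ?_ (by positivity)
  unfold dis
  rw [← measure_preimage_add_right volume ((k:ℝ) * (π / 2))
    {φ ∈ Icc (0:ℝ) (2 * π) | t < ‖F φ‖}]
  refine measure_mono ?_
  rintro θ ⟨-, h2⟩
  unfold Gk at h2
  by_cases hm : θ + k * (π / 2) ∈ Ioc (0:ℝ) (2 * π)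
  · rw [indicator_of_mem hm] at h2
    exact ⟨Ioc_subset_Icc_self hm, h2⟩
  · rw [indicator_of_notMem hm, norm_zero] at h2
    linarith

lemma split5 {H : ℝ → ℂ} (hH : Integrable H) (h0 : ∀ φ, φ ∉ Ioc (0:ℝ) (2 * π) → H φ = 0) :
    ∫ φ in (0:ℝ)..(2 * π), H φ =
      ∑ k ∈ Finset.range 5, ∫ θ in arc, H (θ + k * (π / 2)) := by
  have hpi := pi_pos
  have h1 : ∀ k : ℕ, ∫ θ in arc, H (θ + k * (π / 2)) =
      ∫ φ in ((fun k : ℕ => -(π / 4) + k * (π / 2)) k)..((fun k : ℕ => -(π / 4) + k * (π / 2)) (k + 1)), H φ := by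
    intro k
    unfold arc
    rw [← intervalIntegral.integral_of_le (by linarith),
      intervalIntegral.integral_comp_add_right]
    congr 1
    push_cast
    ring
  simp_rw [h1]
  rw [intervalIntegral.sum_integral_adjacent_intervals (fun k _ => hH.intervalIntegrable)]
  have e1 : ∀ a b : ℝ, a ≤ 0 → 2 * π ≤ b → ∫ φ in a..b, H φ = ∫ φ, H φ := by
    intro a b ha hb
    rw [intervalIntegral.integral_of_le (by linarith)]
    refine setIntegral_eq_integral_of_forall_compl_eq_zero (fun φ hφ => h0 φ (fun h => hφ ?_))
    exact ⟨by linarith [h.1], by linarith [h.2]⟩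
  rw [e1 _ _ le_rfl le_rfl, e1]
  · simp; linarith
  · push_cast; linarith

lemma Rext_split {F : ℝ → ℂ} (hF : IntegrableOn F (Ioc (0:ℝ) (2 * π))) (x y : ℝ) :
    Rext F x y = Complex.ofReal (1 / (2 * π)) *
      (TT (Gk F 0) y x + TT (Gk F 1) (-x) y + TT (Gk F 2) (-y) (-x) + TT (Gk F 3) x (-y) +
        TT (Gk F 4) y x) := by
  unfold Rext
  congr 1
  have hpi := pi_pos
  have hI : Integrable ((Ioc (0:ℝ) (2 * π)).indicator F) :=
    (integrable_indicator_iff measurableSet_Ioc).2 hF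
  have hE : Continuous (fun φ : ℝ => ep (x * cos φ + y * sin φ)) := ep_cont.comp (by fun_prop)
  have hH : Integrable (fun φ => (Ioc (0:ℝ) (2 * π)).indicator F φ * ep (x * cos φ + y * sin φ)) := by
    refine hI.mul_bdd (c := 1) hE.aestronglyMeasurable (Eventually.of_forall fun φ => ?_)
    rw [ep_norm]
  have h1 : ∫ φ in (0:ℝ)..(2 * π),
      F φ * Complex.exp (Complex.I * Complex.ofReal (x * Real.cos φ + y * Real.sin φ)) =
      ∫ φ in (0:ℝ)..(2 * π), (Ioc (0:ℝ) (2 * π)).indicator F φ * ep (x * cos φ + y * sin φ) := by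
    rw [intervalIntegral.integral_of_le (by linarith), intervalIntegral.integral_of_le (by linarith)]
    refine setIntegral_congr_fun measurableSet_Ioc (fun φ hφ => ?_)
    simp only [indicator_of_mem hφ, ep]
  rw [h1, split5 hH (fun φ hφ => by simp [indicator_of_notMem hφ])]
  simp only [Finset.sum_range_succ, Finset.sum_range_zero, zero_add]
  have c1 : ∀ θ : ℝ, cos (θ + ((1:ℕ):ℝ) * (π / 2)) = - sin θ := fun θ => by
    rw [Nat.cast_one, one_mul, cos_add_pi_div_two]
  have d1 : ∀ θ : ℝ, sin (θ + ((1:ℕ):ℝ) * (π / 2)) = cos θ := fun θ => by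
    rw [Nat.cast_one, one_mul, sin_add_pi_div_two]
  have c2 : ∀ θ : ℝ, cos (θ + ((2:ℕ):ℝ) * (π / 2)) = - cos θ := fun θ => by
    rw [show θ + ((2:ℕ):ℝ) * (π / 2) = θ + π by push_cast; ring, cos_add_pi]
  have d2 : ∀ θ : ℝ, sin (θ + ((2:ℕ):ℝ) * (π / 2)) = - sin θ := fun θ => by
    rw [show θ + ((2:ℕ):ℝ) * (π / 2) = θ + π by push_cast; ring, sin_add_pi]
  have c3 : ∀ θ : ℝ, cos (θ + ((3:ℕ):ℝ) * (π / 2)) = sin θ := fun θ => by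
    rw [show θ + ((3:ℕ):ℝ) * (π / 2) = θ + π / 2 + π by push_cast; ring, cos_add_pi,
      cos_add_pi_div_two, neg_neg]
  have d3 : ∀ θ : ℝ, sin (θ + ((3:ℕ):ℝ) * (π / 2)) = - cos θ := fun θ => by
    rw [show θ + ((3:ℕ):ℝ) * (π / 2) = θ + π / 2 + π by push_cast; ring, sin_add_pi,
      sin_add_pi_div_two]
  have c4 : ∀ θ : ℝ, cos (θ + ((4:ℕ):ℝ) * (π / 2)) = cos θ := fun θ => by
    rw [show θ + ((4:ℕ):ℝ) * (π / 2) = θ + 2 * π by push_cast; ring, cos_add_two_pi]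
  have d4 : ∀ θ : ℝ, sin (θ + ((4:ℕ):ℝ) * (π / 2)) = sin θ := fun θ => by
    rw [show θ + ((4:ℕ):ℝ) * (π / 2) = θ + 2 * π by push_cast; ring, sin_add_two_pi]
  have c0 : ∀ θ : ℝ, θ + ((0:ℕ):ℝ) * (π / 2) = θ := fun θ => by simp
  unfold TT Gk
  simp only [c1, d1, c2, d2, c3, d3, c4, d4]
  congr 1
  · congr 1
    · congr 1
      · congr 1
        · congr 1; ext θ; rw [c0, add_comm (x * _)]
        · congr 1; ext θ; ring_nf
      · congr 1; ext θ; congr 2; ring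
    · congr 1; ext θ; congr 2; ring
  · congr 1; ext θ; rw [add_comm (x * _)]

/-- The five coordinate changes. -/
def phi (k : ℕ) (p : ℝ × ℝ) : ℝ × ℝ :=
  if k = 1 then (-p.1, p.2) else if k = 2 then (-p.2, -p.1) else if k = 3 then (p.1, -p.2)
  else (p.2, p.1)

lemma phi_mp (k : ℕ) : MeasurePreserving (phi k) volume volume := by
  have hn : MeasurePreserving (fun x : ℝ => -x) volume volume := Measure.measurePreserving_neg volume
  have hi : MeasurePreserving (fun x : ℝ => x) volume volume := MeasurePreserving.id volume
  have hsw : MeasurePreserving (Prod.swap : ℝ × ℝ → ℝ × ℝ) volume volume :=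
    Measure.measurePreserving_swap
  have a1 : MeasurePreserving (fun p : ℝ × ℝ => (-p.1, p.2)) volume volume := hn.prod hi
  have a3 : MeasurePreserving (fun p : ℝ × ℝ => (p.1, -p.2)) volume volume := hi.prod hn
  have a2 : MeasurePreserving (fun p : ℝ × ℝ => (-p.2, -p.1)) volume volume := (hn.prod hn).comp hsw
  unfold phi
  split_ifs
  · exact a1
  · exact a2
  · exact a3
  · exact hsw

lemma lvlset_meas {G : ℝ → ℂ} (hG : Measurable G) (a b t : ℝ) : MeasurableSet
    {z : ℝ × ℝ | t < ‖TT G z.1 z.2‖ * ((1 + |z.1|) ^ (-a) * (1 + |z.2|) ^ (-b))} := by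
  have hf : Measurable (fun z : ℝ × ℝ => 1 + |z.1|) := measurable_const.add measurable_fst.abs
  have hs : Measurable (fun z : ℝ × ℝ => 1 + |z.2|) := measurable_const.add measurable_snd.abs
  exact measurableSet_lt measurable_const
    ((TT_meas hG).norm.mul ((hf.pow_const _).mul (hs.pow_const _)))

lemma five {t w a b c d e : ℝ}
    (h : t < (a + b + c + d + e) * w) : t / 5 < a * w ∨ t / 5 < b * w ∨ t / 5 < c * w ∨
      t / 5 < d * w ∨ t / 5 < e * w := by
  by_contra hcon
  push Not at hcon
  obtain ⟨h1, h2, h3, h4, h5⟩ := hcon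
  nlinarith

lemma Rab_le {F : ℝ → ℂ} (hF : IntegrableOn F (Ioc (0:ℝ) (2 * π))) (α β x y : ℝ) :
    ‖Rab α β F x y‖ ≤ (‖TT (Gk F 0) y x‖ + ‖TT (Gk F 1) (-x) y‖ + ‖TT (Gk F 2) (-y) (-x)‖ +
      ‖TT (Gk F 3) x (-y)‖ + ‖TT (Gk F 4) y x‖) * ((1 + |x|) ^ (-α) * (1 + |y|) ^ (-β)) := by
  unfold Rab
  have hw : 0 ≤ (1 + |x|) ^ (-α) * (1 + |y|) ^ (-β) := by positivity
  rw [Rext_split hF, norm_mul, norm_mul, Complex.norm_of_nonneg hw,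
    Complex.norm_of_nonneg (by positivity)]
  refine mul_le_mul_of_nonneg_right ?_ hw
  have h1 : 1 / (2 * π) ≤ 1 := by
    rw [div_le_one (by positivity)]
    linarith [pi_gt_three]
  refine le_trans (mul_le_of_le_one_left (norm_nonneg _) h1) ?_
  refine (norm_add_le _ _).trans (add_le_add ?_ le_rfl)
  refine (norm_add_le _ _).trans (add_le_add ?_ le_rfl)
  refine (norm_add_le _ _).trans (add_le_add ?_ le_rfl)
  exact norm_add_le _ _

lemma wplane_fin {g : ℝ × ℝ → ℂ} {q K : ℝ} {S : ℝ≥0∞} (hq : 0 < q) (hK : 0 < K)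
    (h : ∀ d t : ℝ, 0 < d → 0 < t → S ≤ ENNReal.ofReal d →
      volume {p : ℝ × ℝ | t < ‖g p‖} ≤ ENNReal.ofReal (K * (d / t) ^ q)) :
    wplane q g ≤ ENNReal.ofReal (K ^ (1 / q)) * S := by
  by_cases hS : S = ⊤
  · rw [hS, ENNReal.mul_top]
    · exact le_top
    · exact (ENNReal.ofReal_pos.2 (by positivity)).ne'
  have hK' : 0 < K ^ (1 / q) := by positivity
  unfold wplane
  refine iSup₂_le (fun t ht => ?_)
  have key : ∀ d : ℝ, 0 < d → S ≤ ENNReal.ofReal d →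
      ENNReal.ofReal t * (volume {p : ℝ × ℝ | t < ‖g p‖}) ^ (1 / q) ≤
        ENNReal.ofReal (K ^ (1 / q) * d) := by
    intro d hd hSd
    calc _ ≤ ENNReal.ofReal t * (ENNReal.ofReal (K * (d / t) ^ q)) ^ (1 / q) :=
          mul_le_mul_right (ENNReal.rpow_le_rpow (h d t hd ht hSd) (by positivity)) _
      _ = _ := by
          rw [ENNReal.ofReal_rpow_of_pos (by positivity), ← ENNReal.ofReal_mul ht.le,
            mul_rpow hK.le (by positivity), ← rpow_mul (by positivity), mul_one_div_cancel hq.ne',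
            rpow_one]
          congr 1
          field_simp
  refine ENNReal.le_of_forall_pos_le_add (fun ε hε _ => ?_)
  have hε' : (0:ℝ) < ε := hε
  have h0 : 0 ≤ S.toReal := ENNReal.toReal_nonneg
  have hε2 : 0 < (ε:ℝ) / K ^ (1 / q) := by positivity
  refine (key (S.toReal + ε / K ^ (1 / q)) (by positivity) ?_).trans (le_of_eq ?_)
  · conv_lhs => rw [← ENNReal.ofReal_toReal hS]
    exact ENNReal.ofReal_le_ofReal (by linarith)
  · rw [mul_add, mul_div_cancel₀ _ hK'.ne', ENNReal.ofReal_add (by positivity) hε'.le,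
      ENNReal.ofReal_mul hK'.le, ENNReal.ofReal_toReal hS, ENNReal.ofReal_coe_nnreal]

lemma Rab_not_int {F : ℝ → ℂ} (hF : ¬ IntegrableOn F (Ioc (0:ℝ) (2 * π))) (α β x y : ℝ) :
    Rab α β F x y = 0 := by
  have hpi := pi_pos
  unfold Rab Rext
  rw [intervalIntegral.integral_of_le (by linarith), integral_undef, mul_zero, zero_mul]
  intro h
  apply hF
  have hE : Continuous (fun φ : ℝ => ep (-(x * cos φ + y * sin φ))) := ep_cont.comp (by fun_prop)
  have h2 := h.mul_bdd (c := 1) hE.aestronglyMeasurable (Eventually.of_forall fun φ => by rw [ep_norm])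
  refine h2.congr (Eventually.of_forall fun φ => ?_)
  have e : Complex.exp (Complex.I * Complex.ofReal (x * Real.cos φ + y * Real.sin φ)) =
    ep (x * cos φ + y * sin φ) := rfl
  simp only
  rw [e, mul_assoc, ← ep_add, add_neg_cancel]
  simp [ep]

lemma part1 {α β q : ℝ} (hβ0 : 0 ≤ β) (hβα : β ≤ α) (hq : 0 < q)
    (hα : α < 1 / q) {r : ℝ} (hr : 1 ≤ r) (h1 : 2 / q - 1 / 2 < α + β)
    (h2 : 3 / q - (1 - 1 / r) ≤ α + 2 * β) :
      ∃ C : ℝ, 0 < C ∧ ∀ F : ℝ → ℂ, Measurable F →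
        wplane q (fun p => Rab α β F p.1 p.2) ≤ ENNReal.ofReal C * lorentz1 r F := by
  have hr0 : 0 < r := by linarith
  have hρ1 : 1 / r ≤ 1 := by rw [div_le_one hr0]; exact hr
  have hρ : 0 < 1 / r := by positivity
  obtain ⟨C1, hC1, hw1⟩ := weakT hq (hβ0.trans hβα) hβ0 hα (hβα.trans_lt hα) hρ hρ1 h1 h2
  obtain ⟨C2, hC2, hw2⟩ := weakT hq hβ0 (hβ0.trans hβα) (hβα.trans_lt hα) hα hρ hρ1
    (by linarith) (by linarith : 3 / q - (1 - 1 / r) ≤ β + 2 * α)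
  refine ⟨((3 * C2 + 2 * C1) * 5 ^ q) ^ (1 / q), by positivity, fun F hF => ?_⟩
  refine wplane_fin hq (by positivity) (fun d t hd ht hS => ?_)
  by_cases hI : IntegrableOn F (Ioc (0:ℝ) (2 * π))
  swap
  · simp only [Rab_not_int hI, norm_zero, not_lt.2 ht.le]
    simp
  have v1 : ∀ k, volume (phi k ⁻¹' {z : ℝ × ℝ | t / 5 < ‖TT (Gk F k) z.1 z.2‖ *
      ((1 + |z.1|) ^ (-α) * (1 + |z.2|) ^ (-β))}) ≤ ENNReal.ofReal (C1 * (d / (t / 5)) ^ q) := by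
    intro k
    rw [(phi_mp k).measure_preimage (lvlset_meas (Gk_meas hF k) _ _ _).nullMeasurableSet]
    exact hw1 _ (Gk_meas hF k) d (t / 5) hd (by positivity) ((Gk_dis F k hr).trans hS)
  have v2 : ∀ k, volume (phi k ⁻¹' {z : ℝ × ℝ | t / 5 < ‖TT (Gk F k) z.1 z.2‖ *
      ((1 + |z.1|) ^ (-β) * (1 + |z.2|) ^ (-α))}) ≤ ENNReal.ofReal (C2 * (d / (t / 5)) ^ q) := by
    intro k
    rw [(phi_mp k).measure_preimage (lvlset_meas (Gk_meas hF k) _ _ _).nullMeasurableSet]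
    exact hw2 _ (Gk_meas hF k) d (t / 5) hd (by positivity) ((Gk_dis F k hr).trans hS)
  have hcov : {p : ℝ × ℝ | t < ‖Rab α β F p.1 p.2‖} ⊆
      phi 0 ⁻¹' {z : ℝ × ℝ | t / 5 < ‖TT (Gk F 0) z.1 z.2‖ *
      ((1 + |z.1|) ^ (-β) * (1 + |z.2|) ^ (-α))} ∪
      (phi 1 ⁻¹' {z : ℝ × ℝ | t / 5 < ‖TT (Gk F 1) z.1 z.2‖ *
      ((1 + |z.1|) ^ (-α) * (1 + |z.2|) ^ (-β))} ∪
      (phi 2 ⁻¹' {z : ℝ × ℝ | t / 5 < ‖TT (Gk F 2) z.1 z.2‖ *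
      ((1 + |z.1|) ^ (-β) * (1 + |z.2|) ^ (-α))} ∪
      (phi 3 ⁻¹' {z : ℝ × ℝ | t / 5 < ‖TT (Gk F 3) z.1 z.2‖ *
      ((1 + |z.1|) ^ (-α) * (1 + |z.2|) ^ (-β))} ∪
      phi 4 ⁻¹' {z : ℝ × ℝ | t / 5 < ‖TT (Gk F 4) z.1 z.2‖ *
      ((1 + |z.1|) ^ (-β) * (1 + |z.2|) ^ (-α))}))) := by
    rintro ⟨x, y⟩ hp
    have hp' : t < ‖Rab α β F x y‖ := hp
    have h5 := five (hp'.trans_le (Rab_le hI α β x y))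
    simp only [mem_union, mem_preimage, mem_ofPred_eq, phi]
    norm_num only [if_true, if_false, abs_neg]
    rw [mul_comm ((1 + |y|) ^ (-β))]
    exact h5
  have hE : ∀ C : ℝ, C * (d / (t / 5)) ^ q = C * 5 ^ q * (d / t) ^ q := by
    intro C
    rw [show d / (t / 5) = 5 * (d / t) by field_simp, mul_rpow (by norm_num) (by positivity)]
    ring
  calc _ ≤ _ := measure_mono hcov
    _ ≤ _ := measure_union_le _ _
    _ ≤ _ := add_le_add le_rfl (measure_union_le _ _)
    _ ≤ _ := add_le_add le_rfl (add_le_add le_rfl (measure_union_le _ _))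
    _ ≤ _ := add_le_add le_rfl (add_le_add le_rfl (add_le_add le_rfl (measure_union_le _ _)))
    _ ≤ _ := add_le_add (v2 0) (add_le_add (v1 1) (add_le_add (v2 2) (add_le_add (v1 3) (v2 4))))
    _ = _ := by
      have p1 : 0 ≤ C1 * (d / (t / 5)) ^ q := by positivity
      have p2 : 0 ≤ C2 * (d / (t / 5)) ^ q := by positivity
      rw [← ENNReal.ofReal_add p1 p2, ← ENNReal.ofReal_add p2 (by linarith),
        ← ENNReal.ofReal_add p1 (by linarith), ← ENNReal.ofReal_add p2 (by linarith), hE, hE]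
      congr 1
      ring

lemma lor_le (F : ℝ → ℂ) {r : ℝ} (hr : 0 < r) :
    lorentz1 r F ≤ ENNReal.ofReal ((2 * π) ^ (1 / r)) * circleLp ⊤ F := by
  have hpi := pi_pos
  unfold lorentz1 circleLp
  rw [eLpNorm_exponent_top]
  set M := eLpNormEssSup F (volume.restrict (Ioc (0:ℝ) (2 * π))) with hM
  by_cases hMt : M = ⊤
  · rw [hMt, ENNReal.mul_top]
    · exact le_top
    · exact (ENNReal.ofReal_pos.2 (by positivity)).ne'
  have hv : ∀ t : ℝ, 0 < t → (volume {φ ∈ Icc (0:ℝ) (2 * π) | t < ‖F φ‖}) ^ (1 / r) ≤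
      (Ioo (0:ℝ) M.toReal).indicator (fun _ => ENNReal.ofReal ((2 * π) ^ (1 / r))) t +
      ({M.toReal} : Set ℝ).indicator (fun _ => ⊤) t := by
    intro t ht
    rcases lt_trichotomy t M.toReal with h | h | h
    · refine le_trans ?_ le_self_add
      rw [indicator_of_mem (show t ∈ Ioo (0:ℝ) M.toReal from ⟨ht, h⟩),
        ← ENNReal.ofReal_rpow_of_pos (by positivity)]
      refine ENNReal.rpow_le_rpow ?_ (by positivity)
      calc _ ≤ volume (Icc (0:ℝ) (2 * π)) := measure_mono (fun _ h => h.1)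
        _ = _ := by rw [Real.volume_Icc, sub_zero]
    · refine le_trans ?_ le_add_self
      rw [indicator_of_mem (show t ∈ ({M.toReal} : Set ℝ) from h)]
      exact le_top
    · have h0 : volume {φ ∈ Icc (0:ℝ) (2 * π) | t < ‖F φ‖} = 0 := by
        have hae : ∀ᵐ φ ∂(volume.restrict (Icc (0:ℝ) (2 * π))), ‖F φ‖ₑ ≤ M := by
          rw [← restrict_Ioc_eq_restrict_Icc]
          exact ae_le_eLpNormEssSup
        rw [ae_restrict_iff' measurableSet_Icc] at hae
        refine measure_mono_null ?_ (ae_iff.1 hae)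
        rintro φ ⟨h1, h2⟩ hcon
        have h3 := hcon h1
        rw [← ofReal_norm, ← ENNReal.ofReal_toReal hMt,
          ENNReal.ofReal_le_ofReal_iff ENNReal.toReal_nonneg] at h3
        linarith
      rw [h0, ENNReal.zero_rpow_of_pos (by positivity)]
      exact zero_le
  calc _ ≤ ∫⁻ t in Ioi (0:ℝ), ((Ioo (0:ℝ) M.toReal).indicator
          (fun _ => ENNReal.ofReal ((2 * π) ^ (1 / r))) t +
          ({M.toReal} : Set ℝ).indicator (fun _ => ⊤) t) :=
        setLIntegral_mono' measurableSet_Ioi hv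
    _ ≤ ∫⁻ t : ℝ, ((Ioo (0:ℝ) M.toReal).indicator
          (fun _ => ENNReal.ofReal ((2 * π) ^ (1 / r))) t +
          ({M.toReal} : Set ℝ).indicator (fun _ => ⊤) t) := setLIntegral_le_lintegral _ _
    _ = _ := by
        rw [lintegral_add_left (measurable_const.indicator measurableSet_Ioo),
          lintegral_indicator measurableSet_Ioo, lintegral_indicator (measurableSet_singleton _),
          setLIntegral_const, setLIntegral_const, Real.volume_Ioo, Real.volume_singleton, mul_zero,
          add_zero, sub_zero, ENNReal.ofReal_toReal hMt]

/-- Lemma 9: restricted weak-type bounds for `R*_{α,β}` when `β ≤ α < 1/q`.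
Part (i) is for `1 ≤ r < ∞` with Lorentz `L^{r,1}` data, part (ii) for `r = ∞`. -/
theorem statement6 (α β q : ℝ) (hβ0 : 0 ≤ β) (hβα : β ≤ α) (hq : 0 < q)
    (hα : α < 1 / q) :
    (∀ r : ℝ, 1 ≤ r → 2 / q - 1 / 2 < α + β → 3 / q - (1 - 1 / r) ≤ α + 2 * β →
      ∃ C : ℝ, 0 < C ∧ ∀ F : ℝ → ℂ, Measurable F →
        wplane q (fun p => Rab α β F p.1 p.2) ≤ ENNReal.ofReal C * lorentz1 r F)
    ∧ (2 / q - 1 / 2 < α + β → 3 / q - 1 < α + 2 * β →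
      ∃ C : ℝ, 0 < C ∧ ∀ F : ℝ → ℂ, Measurable F →
        wplane q (fun p => Rab α β F p.1 p.2) ≤ ENNReal.ofReal C * circleLp ⊤ F) := by
  refine ⟨fun r hr h1 h2 => part1 hβ0 hβα hq hα hr h1 h2, fun h1 h2 => ?_⟩
  obtain ⟨r, hr, hr2⟩ : ∃ r : ℝ, 1 ≤ r ∧ 3 / q - (1 - 1 / r) ≤ α + 2 * β := by
    refine ⟨max 1 (1 / (α + 2 * β - (3 / q - 1))), le_max_left _ _, ?_⟩
    have hp : 0 < α + 2 * β - (3 / q - 1) := by linarith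
    have : 1 / max 1 (1 / (α + 2 * β - (3 / q - 1))) ≤ α + 2 * β - (3 / q - 1) := by
      rw [one_div_le (by positivity) hp]
      exact le_max_right _ _
    linarith
  obtain ⟨C, hC, h⟩ := part1 hβ0 hβα hq hα hr h1 hr2
  have hr0 : 0 < r := by linarith
  refine ⟨C * (2 * π) ^ (1 / r), by positivity, fun F hF => ?_⟩
  refine (h F hF).trans ?_
  rw [ENNReal.ofReal_mul hC.le, mul_assoc]
  exact mul_le_mul_right (lor_le F hr0) _
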